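/- Izumi's Theorem: Let (A, 𝔪_A) be a Noetherian local ring which is analytically irreducible, i.e. whose 𝔪_A-adic completion Â is an integral domain. For nonzero x ∈ A let ν(x) = max{ n ∈ ℕ : x ∈ 𝔪_A^n } denote the 𝔪_A-adic order of x. Then there exist a real (or integer) b ≥ 1 and an integer d ≥ 0 such that for all nonzero x, y ∈ A: ν(x·y) ≤ b·(ν(x) + ν(y)) + d. -/

import Mathlib

/-!
# Izumi's Theorem
-/

open IsLocalRing

/-- The `𝔪_A`-adic order of an element of a Noetherian local ring:
`ord x = max {n : x ∈ 𝔪_A ^ n}` (well defined for `x ≠ 0` by the Krull intersection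
theorem). -/
noncomputable def mAdicOrder (A : Type*) [CommRing A] [IsLocalRing A] (x : A) : ℕ :=
  sSup {n : ℕ | x ∈ maximalIdeal A ^ n}

universe u


namespace Izumi

/-- Complete local rings whose maximal ideal is generated by a quasi-regular family. -/
structure QRing (R : Type*) [CommRing R] [IsLocalRing R] {ι : Type*} (t : ι → R) : Prop where
  span_eq : Ideal.span (Set.range t) = maximalIdeal R
  qr : ∀ (n : ℕ) (Φ : MvPolynomial ι R), Φ.IsHomogeneous n →
    MvPolynomial.eval t Φ ∈ maximalIdeal R ^ (n+1) → ∀ d, Φ.coeff d ∈ maximalIdeal R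
  compl : ∀ f : ℕ → R, (∀ n, f (n+1) - f n ∈ maximalIdeal R ^ n) →
    ∃ l, ∀ n, l - f n ∈ maximalIdeal R ^ n
  haus : ∀ x : R, (∀ n, x ∈ maximalIdeal R ^ n) → x = 0

/-- `φ` is the initial form of `f` in degree `n`. -/
def InF {R : Type*} [CommRing R] [IsLocalRing R] {ι : Type*} (t : ι → R) (n : ℕ) (f : R)
    (φ : MvPolynomial ι (ResidueField R)) : Prop :=
  ∃ Φ : MvPolynomial ι R, Φ.IsHomogeneous n ∧ MvPolynomial.eval t Φ = f ∧
    Φ.map (residue R) = φ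

section InF
variable {R : Type*} [CommRing R] [IsLocalRing R] {ι : Type*} {t : ι → R}

theorem InF.hom {n : ℕ} {f : R} {φ} (h : InF t n f φ) : φ.IsHomogeneous n := by
  obtain ⟨Φ, h1, h2, rfl⟩ := h
  exact h1.map _

theorem InF.mul {n m : ℕ} {f g : R} {φ ψ} (h : InF t n f φ) (h' : InF t m g ψ) :
    InF t (n+m) (f*g) (φ*ψ) := by
  obtain ⟨Φ, h1, rfl, rfl⟩ := h
  obtain ⟨Ψ, h1', rfl, rfl⟩ := h'
  exact ⟨Φ * Ψ, h1.mul h1', by simp, by simp⟩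

theorem InF.pow {n : ℕ} {f : R} {φ} (h : InF t n f φ) (k : ℕ) :
    InF t (n*k) (f^k) (φ^k) := by
  obtain ⟨Φ, h1, rfl, rfl⟩ := h
  exact ⟨Φ ^ k, h1.pow k, by simp, by simp⟩

theorem InF.sub {n : ℕ} {f g : R} {φ ψ} (h : InF t n f φ) (h' : InF t n g ψ) :
    InF t n (f-g) (φ-ψ) := by
  obtain ⟨Φ, h1, rfl, rfl⟩ := h
  obtain ⟨Ψ, h1', rfl, rfl⟩ := h'
  exact ⟨Φ - Ψ, h1.sub h1', by simp, by simp⟩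

variable (hR : QRing R t)
include hR

theorem QRing.exists_inF {n : ℕ} {f : R} (hf : f ∈ maximalIdeal R ^ n) : ∃ φ, InF t n f φ := by
  rw [← hR.span_eq, Ideal.mem_span_pow_iff_exists_isHomogeneous] at hf
  obtain ⟨Φ, h1, h2⟩ := hf
  exact ⟨_, Φ, h1, h2, rfl⟩

theorem InF.mem {n : ℕ} {f : R} {φ} (h : InF t n f φ) : f ∈ maximalIdeal R ^ n := by
  rw [← hR.span_eq, Ideal.mem_span_pow_iff_exists_isHomogeneous]
  obtain ⟨Φ, h1, h2, _⟩ := h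
  exact ⟨Φ, h1, h2⟩

theorem InF.mem_succ {n : ℕ} {f : R} (h : InF t n f 0) : f ∈ maximalIdeal R ^ (n+1) := by
  obtain ⟨Φ, h1, rfl, h3⟩ := h
  rw [MvPolynomial.eval_eq]
  refine Ideal.sum_mem _ fun d hd => ?_
  have hc : Φ.coeff d ∈ maximalIdeal R := by
    rw [← residue_eq_zero_iff, ← MvPolynomial.coeff_map, h3, MvPolynomial.coeff_zero]
  have hm : InF t n (∏ i ∈ d.support, t i ^ d i) (MvPolynomial.monomial d 1) := by
    refine ⟨MvPolynomial.monomial d 1, ?_, ?_, by simp⟩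
    · apply MvPolynomial.isHomogeneous_monomial
      rw [Finsupp.degree_eq_weight_one]
      exact h1 (MvPolynomial.mem_support_iff.1 hd)
    · rw [MvPolynomial.eval_monomial]; simp [Finsupp.prod]
  rw [pow_succ']
  exact Ideal.mul_mem_mul hc (hm.mem hR)

theorem InF.eq_zero {n : ℕ} {f : R} {φ} (h : InF t n f φ) (hf : f ∈ maximalIdeal R ^ (n+1)) :
    φ = 0 := by
  obtain ⟨Φ, h1, rfl, rfl⟩ := h
  ext d
  rw [MvPolynomial.coeff_map, MvPolynomial.coeff_zero, residue_eq_zero_iff]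
  exact hR.qr n Φ h1 hf d

omit hR in
theorem exists_lift {n : ℕ} {φ : MvPolynomial ι (ResidueField R)} (h : φ.IsHomogeneous n) :
    ∃ f, InF t n f φ := by
  obtain ⟨Ψ, hΨ⟩ := MvPolynomial.map_surjective (residue R) residue_surjective φ
  refine ⟨_, MvPolynomial.homogeneousComponent n Ψ, 
    MvPolynomial.homogeneousComponent_isHomogeneous _ _, rfl, ?_⟩
  rw [← MvPolynomial.homogeneousComponent_eq_self h, ← hΨ]
  ext d
  rw [MvPolynomial.coeff_map, MvPolynomial.coeff_homogeneousComponent,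
    MvPolynomial.coeff_homogeneousComponent, MvPolynomial.coeff_map]
  split_ifs <;> simp

theorem QRing.mul_notMem {a b : ℕ} {f g : R} (hf : f ∉ maximalIdeal R ^ (a+1))
    (hg : g ∉ maximalIdeal R ^ (b+1)) : f * g ∉ maximalIdeal R ^ (a+b+1) := by
  classical
  have key : ∀ {f : R} {a : ℕ}, f ∉ maximalIdeal R ^ (a+1) → ∃ a' φ, a' ≤ a ∧ InF t a' f φ ∧ φ ≠ 0 := by
    intro f a hf
    have hex : ∃ n, f ∉ maximalIdeal R ^ (n+1) := ⟨a, hf⟩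
    have h1 := Nat.find_spec hex
    have h2 : f ∈ maximalIdeal R ^ (Nat.find hex) := by
      rcases h : Nat.find hex with _ | k
      · simp
      · by_contra h3
        exact Nat.find_min hex (m := k) (by omega) h3
    obtain ⟨φ, hφ⟩ := hR.exists_inF h2
    refine ⟨_, φ, Nat.find_le hf, hφ, ?_⟩
    rintro rfl
    exact h1 (hφ.mem_succ hR)
  obtain ⟨a', φ, ha', hφ, hφ0⟩ := key hf
  obtain ⟨b', ψ, hb', hψ, hψ0⟩ := key hg
  intro hfg
  have := (hφ.mul hψ).eq_zero hR (Ideal.pow_le_pow_right (by omega) hfg)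
  exact mul_ne_zero hφ0 hψ0 this

theorem QRing.exists_order {f : R} (hf : f ≠ 0) : ∃ n, f ∈ maximalIdeal R ^ n ∧ f ∉ maximalIdeal R ^ (n+1) := by
  classical
  have hex : ∃ n, f ∉ maximalIdeal R ^ (n+1) := by
    by_contra! h
    exact hf (hR.haus f fun n => Ideal.pow_le_pow_right (by omega) (h n))
  refine ⟨Nat.find hex, ?_, Nat.find_spec hex⟩
  rcases h : Nat.find hex with _ | k
  · simp
  · by_contra h3
    exact Nat.find_min hex (m := k) (by omega) h3

theorem QRing.isDomain : IsDomain R := by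
  have : NoZeroDivisors R := ⟨by
    intro a b hab
    by_contra! h
    obtain ⟨n, _, hn⟩ := hR.exists_order h.1
    obtain ⟨m, _, hm⟩ := hR.exists_order h.2
    exact hR.mul_notMem hn hm (hab ▸ zero_mem _)⟩
  exact NoZeroDivisors.to_isDomain R

end InF

/-- divisibility lemma in polynomial rings -/
theorem ufd_lemma {ι k : Type*} [Field k] {φ ψ : MvPolynomial ι k} (hφ : φ ≠ 0) {n D j : ℕ}
    (hn : φ.totalDegree ≤ n) (hj : D * n < j) (h : φ ^ j ∣ φ ^ D * ψ ^ j) : φ ∣ ψ := by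
  obtain ⟨φ', ψ', c, hrel, rfl, rfl⟩ := UniqueFactorizationMonoid.exists_reduced_factors φ hφ ψ
  have hc : c ≠ 0 := left_ne_zero_of_mul hφ
  have hφ' : φ' ≠ 0 := right_ne_zero_of_mul hφ
  have h2 : φ' ^ j ∣ (c * φ') ^ D := by
    have : c ^ j * φ' ^ j ∣ c ^ j * ((c * φ') ^ D * ψ' ^ j) := by
      convert h using 1 <;> ring
    have := (mul_dvd_mul_iff_left (pow_ne_zero j hc)).1 this
    exact (hrel.pow).dvd_of_dvd_mul_right this
  have h0 : φ'.totalDegree = 0 := by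
    by_contra hne
    obtain ⟨w, hw⟩ := h2
    have hpow : ∀ (f : MvPolynomial ι k), f ≠ 0 → ∀ m, (f ^ m).totalDegree = m * f.totalDegree := by
      intro f hf m
      induction m with
      | zero => simp
      | succ m ih =>
        rw [pow_succ, MvPolynomial.totalDegree_mul_of_isDomain (pow_ne_zero _ hf) hf, ih]; ring
    have hw0 : w ≠ 0 := by
      rintro rfl
      rw [mul_zero] at hw
      exact pow_ne_zero _ hφ hw
    have h3 := congrArg MvPolynomial.totalDegree hw
    rw [hpow _ hφ, MvPolynomial.totalDegree_mul_of_isDomain (pow_ne_zero _ hφ') hw0, hpow _ hφ'] at h3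
    have h4 : D * (c * φ').totalDegree ≤ D * n := Nat.mul_le_mul_left _ hn
    have h5 : j * 1 ≤ j * φ'.totalDegree := Nat.mul_le_mul_left _ (by omega)
    omega
  have hu : IsUnit φ' := by
    rw [MvPolynomial.isUnit_iff_totalDegree_of_isReduced]
    refine ⟨?_, h0⟩
    rw [isUnit_iff_ne_zero]
    intro h6
    rw [MvPolynomial.totalDegree_eq_zero_iff_eq_C, h6, map_zero] at h0
    exact hφ' h0
  exact mul_dvd_mul_left c (hu.dvd)

end Izumi


namespace Izumi

/-- A valuation extending the order function of `R`. -/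
structure ValExt (R : Type*) {L Γ : Type*} [CommRing R] [IsLocalRing R] [Field L] [Algebra R L]
    [LinearOrderedCommGroupWithZero Γ] (v : Valuation L Γ) (g : Γ) : Prop where
  g0 : g ≠ 0
  g1 : g < 1
  ord : ∀ n (r : R), r ∈ maximalIdeal R ^ n → r ∉ maximalIdeal R ^ (n+1) →
    v (algebraMap R L r) = g ^ n
  int : ∀ z : L, IsIntegral R z → v z ≤ 1
  bdd : ∀ z : L, ∃ c : ℕ, v z * g ^ c ≤ 1

section
variable {R L Γ ι : Type*} [CommRing R] [IsLocalRing R] [Field L] [Algebra R L]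
    [LinearOrderedCommGroupWithZero Γ] {v : Valuation L Γ} {g : Γ} {t : ι → R}

theorem ValExt.pow_pos (hv : ValExt R v g) (n : ℕ) : 0 < g ^ n :=
  zero_lt_iff.2 (pow_ne_zero _ hv.g0)

theorem ValExt.pow_le (hv : ValExt R v g) {m n : ℕ} (h : m ≤ n) : g ^ n ≤ g ^ m :=
  pow_le_pow_right_of_le_one' hv.g1.le h

theorem ValExt.pow_lt (hv : ValExt R v g) {m n : ℕ} (h : m < n) : g ^ n < g ^ m := by
  refine lt_of_le_of_ne (hv.pow_le h.le) fun h2 => ?_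
  have h3 : g ^ (m+1) = g ^ m := le_antisymm (hv.pow_le (by omega)) (h2 ▸ hv.pow_le h)
  rw [pow_succ] at h3
  have := mul_left_cancel₀ (pow_ne_zero _ hv.g0) (h3.trans (mul_one _).symm)
  exact hv.g1.ne this

theorem ValExt.eq_zero (hv : ValExt R v g) {z : L} (h : ∀ M : ℕ, v z ≤ g ^ M) : z = 0 := by
  by_contra hz
  obtain ⟨c, hc⟩ := hv.bdd z⁻¹
  have h1 := h (c+1)
  have hz' : v z ≠ 0 := (Valuation.ne_zero_iff v).2 hz
  rw [map_inv₀, inv_mul_le_one₀ (zero_lt_iff.2 hz')] at hc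
  exact absurd (hc.trans h1) (not_le.2 (hv.pow_lt (by omega)))

theorem ValExt.le_iff (hv : ValExt R v g) (hR : QRing R t) {n : ℕ} {r : R} :
    v (algebraMap R L r) ≤ g ^ n ↔ r ∈ maximalIdeal R ^ n := by
  by_cases hr : r = 0
  · simp [hr]
  obtain ⟨m, hm, hm'⟩ := hR.exists_order hr
  rw [hv.ord m r hm hm']
  constructor
  · intro h
    have : n ≤ m := by
      by_contra hlt
      exact absurd h (not_le.2 (hv.pow_lt (by omega)))
    exact Ideal.pow_le_pow_right this hm
  · intro h
    apply hv.pow_le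
    by_contra hlt
    exact hm' (Ideal.pow_le_pow_right (by omega) h)

theorem ValExt.le_one (hv : ValExt R v g) (r : R) : v (algebraMap R L r) ≤ 1 :=
  hv.int _ isIntegral_algebraMap

theorem ValExt.injective (hv : ValExt R v g) (hR : QRing R t) :
    Function.Injective (algebraMap R L) := by
  rw [injective_iff_map_eq_zero]
  intro a ha
  apply hR.haus
  intro n
  rw [← hv.le_iff hR, ha, map_zero]
  exact zero_le

theorem ValExt.aeval_sub_le (hv : ValExt R v g) (P : Polynomial R) {α β : L} (hα : v α ≤ 1)
    (hβ : v β ≤ 1) : v (Polynomial.aeval α P - Polynomial.aeval β P) ≤ v (α - β) := by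
  induction P using Polynomial.induction_on' with
  | add p q hp hq =>
    rw [map_add, map_add, add_sub_add_comm]
    exact (v.map_add_le hp hq)
  | monomial n r =>
    rw [Polynomial.aeval_monomial, Polynomial.aeval_monomial, ← mul_sub, map_mul]
    have : v (α ^ n - β ^ n) ≤ v (α - β) := by
      induction n with
      | zero => simp
      | succ n ih =>
        rw [show α ^ (n+1) - β ^ (n+1) = α ^ n * (α - β) + (α ^ n - β ^ n) * β by ring]
        refine v.map_add_le ?_ ?_
        · rw [map_mul, map_pow]
          exact mul_le_of_le_one_left' (pow_le_one' hα _)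
        · rw [map_mul]
          exact (mul_le_of_le_one_right' hβ).trans ih
    exact (mul_le_of_le_one_left' (hv.le_one r)).trans this

omit [IsLocalRing R] in
theorem homog_mul {n m : ℕ} {φ η : MvPolynomial ι R} (hφ : φ.IsHomogeneous n)
    (h : (φ * η).IsHomogeneous (n + m)) :
    φ * η = φ * MvPolynomial.homogeneousComponent m η := by
  conv_lhs => rw [← MvPolynomial.homogeneousComponent_eq_self h, ← MvPolynomial.sum_homogeneousComponent η, Finset.mul_sum, map_sum]
  have : ∀ i, MvPolynomial.homogeneousComponent (n+m) (φ * MvPolynomial.homogeneousComponent i η) =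
      if i = m then φ * MvPolynomial.homogeneousComponent i η else 0 := by
    intro i
    rw [MvPolynomial.homogeneousComponent_of_mem
      ((MvPolynomial.mem_homogeneousSubmodule _ _).2 (hφ.mul (MvPolynomial.homogeneousComponent_isHomogeneous i η)))]
    by_cases hi : i = m <;> simp [hi, Ne.symm]
  rw [Finset.sum_congr rfl fun i _ => this i, Finset.sum_ite_eq']
  split_ifs with hm
  · rfl
  · rw [MvPolynomial.homogeneousComponent_eq_zero _ _ (by simpa using hm), mul_zero]

/-- One step of the approximation procedure. -/
theorem ValExt.step (hv : ValExt R v g) (hR : QRing R t) {α : L} {Q : Polynomial R}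
    (hQ : Q.Monic) (hQα : Polynomial.aeval α Q = 0) {F a : R} {n m N : ℕ}
    (hF : F ∈ maximalIdeal R ^ n) (hF' : F ∉ maximalIdeal R ^ (n+1))
    (ha : a ∈ maximalIdeal R ^ (n+m)) (hN : n + (Q.natDegree * n + 1) * m + 1 ≤ N)
    (h : v (algebraMap R L F * α - algebraMap R L a) ≤ g ^ N) :
    ∃ h' : R, a - h' * F ∈ maximalIdeal R ^ (n+m+1) := by
  set D := Q.natDegree with hD
  set j := D * n + 1 with hj
  have hFv : v (algebraMap R L F) = g ^ n := hv.ord n F hF hF'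
  have hF0 : algebraMap R L F ≠ 0 := by
    intro h0
    rw [h0, map_zero] at hFv
    exact pow_ne_zero _ hv.g0 hFv.symm
  set β : L := algebraMap R L a / algebraMap R L F with hβ
  have haβ : algebraMap R L a = algebraMap R L F * β := by rw [hβ]; field_simp
  have hβ1 : v β ≤ 1 := by
    rw [hβ, map_div₀, hFv, div_le_one₀ (hv.pow_pos n)]
    exact (hv.le_iff hR).2 (Ideal.pow_le_pow_right (by omega) ha)
  have hα1 : v α ≤ 1 := hv.int _ ⟨Q, hQ, by rwa [← Polynomial.aeval_def]⟩
  have hαβ : g ^ n * v (β - α) ≤ g ^ N := by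
    rw [← hFv, ← map_mul, mul_sub, ← haβ, Valuation.map_sub_swap]
    exact h
  set r := (Polynomial.X ^ j : Polynomial R) %ₘ Q with hr
  have hrdeg : r.natDegree ≤ D := Polynomial.natDegree_modByMonic_le _ hQ
  set P := (Polynomial.X ^ j : Polynomial R) - r with hP
  have hPα : Polynomial.aeval α P = 0 := by
    have : P = Q * ((Polynomial.X ^ j : Polynomial R) /ₘ Q) := by
      rw [hP, hr, Polynomial.modByMonic_eq_sub_mul_div]; ring
    rw [this, map_mul, hQα, zero_mul]
  have hPβ : v (Polynomial.aeval β P) ≤ v (β - α) := by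
    have := hv.aeval_sub_le P hβ1 hα1
    rwa [hPα, sub_zero] at this
  set ρ : R := ∑ i ∈ Finset.range (D+1), r.coeff i * a ^ i * F ^ (D - i) with hρ
  have hρβ : algebraMap R L ρ = algebraMap R L F ^ D * Polynomial.aeval β r := by
    rw [Polynomial.aeval_eq_sum_range' (n := D+1) (by omega), hρ, map_sum, Finset.mul_sum]
    refine Finset.sum_congr rfl fun i hi => ?_
    rw [map_mul, map_mul, map_pow, map_pow, haβ, Algebra.smul_def, mul_pow]
    have : algebraMap R L F ^ D = algebraMap R L F ^ i * algebraMap R L F ^ (D-i) := by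
      rw [← pow_add]; congr 1; simp at hi; omega
    rw [this]; ring
  have hmem : F ^ D * a ^ j - F ^ j * ρ ∈ maximalIdeal R ^ (n * D + (n+m) * j + 1) := by
    rw [← hv.le_iff (v := v) hR]
    have : algebraMap R L (F ^ D * a ^ j - F ^ j * ρ) =
        algebraMap R L F ^ (D + j) * Polynomial.aeval β P := by
      rw [hP, map_sub, map_sub, map_mul, map_mul, hρβ, map_pow, map_pow, map_pow, haβ, map_pow,
        Polynomial.aeval_X]
      ring
    rw [this, map_mul, map_pow, hFv]
    have e1 : g ^ (n * D + (n+m)*j + 1) = (g ^ n) ^ (D + j) * g ^ (m * j + 1) := by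
      rw [← pow_mul, ← pow_add]; congr 1; ring
    rw [e1]
    refine mul_le_mul_right ?_ _
    refine hPβ.trans ?_
    have h5 : g ^ n * v (β - α) ≤ g ^ n * g ^ (m * j + 1) := by
      refine hαβ.trans ?_
      rw [← pow_add]
      apply hv.pow_le
      rw [mul_comm m j]; omega
    exact le_of_mul_le_mul_left h5 (hv.pow_pos n)
  obtain ⟨φ, hφ⟩ := hR.exists_inF hF
  obtain ⟨ψ, hψ⟩ := hR.exists_inF ha
  have hφ0 : φ ≠ 0 := by
    rintro rfl
    exact hF' (hφ.mem_succ hR)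
  have hL := (hφ.pow D).mul (hψ.pow j)
  have hρm : ρ ∈ maximalIdeal R ^ (n * D + m * j) := by
    by_contra hcon
    have h6 : ∃ s, s < n * D + m * j ∧ ρ ∈ maximalIdeal R ^ s ∧ ρ ∉ maximalIdeal R ^ (s+1) := by
      have hρ0 : ρ ≠ 0 := by rintro h0; rw [h0] at hcon; exact hcon (zero_mem _)
      obtain ⟨s, hs, hs'⟩ := hR.exists_order hρ0
      refine ⟨s, ?_, hs, hs'⟩
      by_contra hle
      exact hcon (Ideal.pow_le_pow_right (by omega) hs)
    obtain ⟨s, hs, hs1, hs2⟩ := h6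
    obtain ⟨χ, hχ⟩ := hR.exists_inF hs1
    have h7 := (hφ.pow j).mul hχ
    have hlt : n * j + s + 1 ≤ n * D + (n + m) * j := by
      rw [add_mul]; omega
    have h8 : F ^ j * ρ ∈ maximalIdeal R ^ (n * j + s + 1) := by
      have := Ideal.sub_mem _ (Ideal.pow_le_pow_right hlt (hL.mem hR))
        (Ideal.pow_le_pow_right (by omega) hmem)
      simpa using this
    have h9 := h7.eq_zero hR h8
    rcases mul_eq_zero.1 h9 with h | h
    · exact pow_ne_zero _ hφ0 h
    · subst h
      exact hs2 (hχ.mem_succ hR)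
  obtain ⟨χ, hχ⟩ := hR.exists_inF hρm
  have hR' := (hφ.pow j).mul hχ
  rw [show n * j + (n * D + m * j) = n * D + (n + m) * j by ring] at hR'
  have h10 := (hL.sub hR').eq_zero hR hmem
  have hdvd : φ ∣ ψ := by
    refine ufd_lemma (n := n) (D := D) (j := j) hφ0 ?_ (by omega) ⟨χ, sub_eq_zero.1 h10⟩
    exact hφ.hom.totalDegree_le
  obtain ⟨η, rfl⟩ := hdvd
  have hη : φ * η = φ * MvPolynomial.homogeneousComponent m η := by
    exact homog_mul hφ.hom hψ.hom
  obtain ⟨h', hh'⟩ := exists_lift (t := t) (MvPolynomial.homogeneousComponent_isHomogeneous m η)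
  refine ⟨h', ?_⟩
  have h12 := hψ.sub (hφ.mul hh')
  rw [hη, sub_self] at h12
  rw [mul_comm]
  exact h12.mem_succ hR

/-- approximation: an integral element which is very well approximated lies in `R`. -/
theorem ValExt.approx1 (hv : ValExt R v g) (hR : QRing R t) {α : L} {Q : Polynomial R}
    (hQ : Q.Monic) (hQα : Polynomial.aeval α Q = 0) {F a : R} {n N : ℕ}
    (hF : F ∈ maximalIdeal R ^ n) (hF' : F ∉ maximalIdeal R ^ (n+1)) (M : ℕ)
    (hN : n + (Q.natDegree * n + 1) * M + 1 ≤ N)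
    (h : v (algebraMap R L F * α - algebraMap R L a) ≤ g ^ N) :
    ∃ h' : R, v (α - algebraMap R L h') ≤ g ^ M := by
  have key : ∀ m, m ≤ M → ∃ h' : R, a - h' * F ∈ maximalIdeal R ^ (n+m) := by
    intro m
    induction m with
    | zero =>
      intro _
      refine ⟨0, ?_⟩
      rw [zero_mul, sub_zero, add_zero, ← hv.le_iff (v := v) hR]
      have : algebraMap R L a = algebraMap R L F * α - (algebraMap R L F * α - algebraMap R L a) := by ring
      rw [this]
      refine v.map_sub_le ?_ (h.trans (hv.pow_le (by omega)))
      rw [map_mul, hv.ord n F hF hF']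
      exact mul_le_of_le_one_right' (hv.int _ ⟨Q, hQ, by rwa [← Polynomial.aeval_def]⟩)
    | succ m ih =>
      intro hm
      obtain ⟨h1, hh1⟩ := ih (by omega)
      have hQ' : (Polynomial.taylor h1 Q).Monic := by
        rw [Polynomial.Monic, Polynomial.leadingCoeff_taylor]; exact hQ
      obtain ⟨h2, hh2⟩ := hv.step hR (α := α - algebraMap R L h1) hQ' (N := N) (m := m)
        (by rw [Polynomial.taylor_apply, Polynomial.aeval_comp]; simpa using hQα)
        hF hF' hh1
        (by
          rw [Polynomial.natDegree_taylor]
          have : (Q.natDegree * n + 1) * m ≤ (Q.natDegree * n + 1) * M :=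
            Nat.mul_le_mul_left _ (by omega)
          omega)
        (by convert h using 2; rw [map_sub, map_mul]; ring)
      have e : a - (h1 + h2) * F = a - h1 * F - h2 * F := by ring
      exact ⟨h1 + h2, by rw [e]; exact hh2⟩
  obtain ⟨h', hh'⟩ := key M le_rfl
  refine ⟨h', ?_⟩
  have h3 : g ^ n * v (α - algebraMap R L h') ≤ g ^ n * g ^ M := by
    rw [← hv.ord n F hF hF', ← map_mul, hv.ord n F hF hF', ← pow_add]
    have : algebraMap R L F * (α - algebraMap R L h') =
      (algebraMap R L F * α - algebraMap R L a) + algebraMap R L (a - h' * F) := by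
      rw [map_sub, map_mul]; ring
    rw [this]
    refine v.map_add_le (h.trans (hv.pow_le ?_)) ((hv.le_iff hR).2 hh')
    have : 1 * M ≤ (Q.natDegree * n + 1) * M := Nat.mul_le_mul_right _ (by omega)
    omega
  exact le_of_mul_le_mul_left h3 (hv.pow_pos n)

theorem ValExt.mem_range (hv : ValExt R v g) (hR : QRing R t) {α : L}
    (h : ∀ M : ℕ, ∃ h' : R, v (α - algebraMap R L h') ≤ g ^ M) :
    α ∈ Set.range (algebraMap R L) := by
  choose f hf using h
  obtain ⟨l, hl⟩ := hR.compl f (fun n => by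
    rw [← hv.le_iff (v := v) hR, map_sub]
    have : algebraMap R L (f (n+1)) - algebraMap R L (f n) =
      (α - algebraMap R L (f n)) - (α - algebraMap R L (f (n+1))) := by ring
    rw [this]
    exact v.map_sub_le (hf n) ((hf (n+1)).trans (hv.pow_le (by omega))))
  refine ⟨l, ?_⟩
  rw [← sub_eq_zero]
  apply hv.eq_zero
  intro M
  have : algebraMap R L l - α = algebraMap R L (l - f M) - (α - algebraMap R L (f M)) := by
    rw [map_sub]; ring
  rw [this]
  exact v.map_sub_le ((hv.le_iff hR).2 (hl M)) (hf M)

theorem ValExt.approx (hv : ValExt R v g) (hR : QRing R t) {α : L} (hα : IsIntegral R α)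
    (h : ∀ C : ℕ, ∃ (n : ℕ) (F a : R), F ∉ maximalIdeal R ^ (n+1) ∧
      v (algebraMap R L F * α - algebraMap R L a) ≤ g ^ (C * (n+1))) :
    α ∈ Set.range (algebraMap R L) := by
  obtain ⟨Q, hQ, hQα⟩ := hα
  rw [← Polynomial.aeval_def] at hQα
  apply hv.mem_range hR
  intro M
  obtain ⟨n, F, a, hF, hFa⟩ := h (2 + (Q.natDegree + 1) * M)
  have hF0 : F ≠ 0 := by rintro rfl; exact hF (zero_mem _)
  obtain ⟨n', h1, h2⟩ := hR.exists_order hF0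
  have hn' : n' ≤ n := by
    by_contra hlt
    exact hF (Ideal.pow_le_pow_right (by omega) h1)
  refine hv.approx1 hR hQ hQα h1 h2 M ?_ hFa
  have : (Q.natDegree * n' + 1) * M ≤ (Q.natDegree * n + 1) * M :=
    Nat.mul_le_mul_right _ (Nat.add_le_add_right (Nat.mul_le_mul_left _ hn') _)
  nlinarith [Nat.zero_le (Q.natDegree * M), Nat.zero_le (n * M)]

/-- normality -/
theorem ValExt.normal (hv : ValExt R v g) (hR : QRing R t) {α : L} (hα : IsIntegral R α)
    {F a : R} (hF : F ≠ 0) (h : algebraMap R L F * α = algebraMap R L a) :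
    α ∈ Set.range (algebraMap R L) := by
  obtain ⟨n', h1, h2⟩ := hR.exists_order hF
  refine hv.approx hR hα fun C => ⟨n', F, a, h2, ?_⟩
  rw [h, sub_self, map_zero]
  exact zero_le

/-- Liouville -/
theorem ValExt.liouville (hv : ValExt R v g) (hR : QRing R t) {α : L} (hα : IsIntegral R α)
    (hα' : α ∉ Set.range (algebraMap R L)) :
    ∃ C : ℕ, ∀ (n : ℕ) (F a : R), F ∉ maximalIdeal R ^ (n+1) →
      ¬ v (algebraMap R L F * α - algebraMap R L a) ≤ g ^ (C * (n+1)) := by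
  by_contra! h
  exact hα' (hv.approx hR hα h)

end
end Izumi


namespace Izumi

section
variable {R K L Γ ι : Type*} [CommRing R] [IsDomain R] [IsLocalRing R] [Field K] [Field L] [Algebra R L]
    [Algebra R K] [Algebra K L] [IsScalarTower R K L] [IsFractionRing R K]
    [FiniteDimensional K L] [IsGalois K L]
    [LinearOrderedCommGroupWithZero Γ] {v : Valuation L Γ} {g : Γ} {t : ι → R}

include K in
theorem ValExt.inv_mem (hv : ValExt R v g) (hR : QRing R t) {z : L} (hz : IsIntegral R z)
    (h : ∀ σ : L ≃ₐ[K] L, σ z = z) : z ∈ Set.range (algebraMap R L) := by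
  have h1 := (IsGalois.mem_bot_iff_fixed z).2 h
  obtain ⟨y, rfl⟩ := IntermediateField.mem_bot.1 h1
  obtain ⟨a, b, hb, rfl⟩ := IsFractionRing.div_surjective (A := R) y
  have hb0 : b ≠ 0 := nonZeroDivisors.ne_zero hb
  refine hv.normal hR hz hb0 (a := a) ?_
  rw [IsScalarTower.algebraMap_apply R K L, IsScalarTower.algebraMap_apply R K L, ← map_mul]
  congr 1
  have : algebraMap R K b ≠ 0 := by simpa using hb0
  field_simp

omit [IsDomain R] [IsLocalRing R] [IsFractionRing R K] [FiniteDimensional K L] [IsGalois K L] in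
theorem int_map (σ : L ≃ₐ[K] L) {x : L} (hx : IsIntegral R x) : IsIntegral R (σ x) :=
  hx.map (σ.toAlgHom.restrictScalars R)

theorem exists_theta [DecidableEq (L ≃ₐ[K] L)] (hinf : Infinite R) (U : Finset (L ≃ₐ[K] L)) (hne : U.Nonempty) (hU : U ≠ Finset.univ) :
    ∃ θ : L, IsIntegral R θ ∧ ∏ σ ∈ U, σ θ ∉ Set.range (algebraMap R L) := by
  obtain ⟨α, hα⟩ := Field.exists_primitive_element K L
  have hαR : IsAlgebraic R α := (IsFractionRing.isAlgebraic_iff R K L).2 (Algebra.IsAlgebraic.isAlgebraic α)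
  obtain ⟨b, hb, hIntg⟩ := hαR.exists_integral_multiple
  have hbL : algebraMap R L b ≠ 0 := by
    rw [IsScalarTower.algebraMap_apply R K L]
    simpa using hb
  have hfix : ∀ (σ : L ≃ₐ[K] L) (r : R), σ (algebraMap R L r) = algebraMap R L r := by
    intro σ r
    rw [IsScalarTower.algebraMap_apply R K L]; simp
  set θ := b • α with hθ
  have hinj : ∀ σ τ : L ≃ₐ[K] L, σ θ = τ θ → σ = τ := by
    intro σ τ h
    rw [hθ, Algebra.smul_def, map_mul, map_mul, hfix, hfix] at h
    have h2 := mul_left_cancel₀ hbL h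
    ext x
    have hx : x ∈ IntermediateField.adjoin K {α} := by rw [hα]; trivial
    induction hx using IntermediateField.adjoin_induction with
    | mem x hx => rw [Set.mem_singleton_iff.1 hx]; exact h2
    | algebraMap x => simp
    | add x y _ _ hx hy => rw [map_add, map_add, hx, hy]
    | inv x _ hx => rw [map_inv₀, map_inv₀, hx]
    | mul x y _ _ hx hy => rw [map_mul, map_mul, hx, hy]
  by_contra! hcon
  have key : ∀ τ : L ≃ₐ[K] L, ∏ σ ∈ U, (Polynomial.X - Polynomial.C (τ (σ θ))) =
      ∏ σ ∈ U, (Polynomial.X - Polynomial.C (σ θ)) := by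
    intro τ
    apply Polynomial.eq_of_infinite_eval_eq
    have hri : (Set.range (algebraMap R L)).Infinite := by
      apply Set.infinite_range_of_injective
      rw [IsScalarTower.algebraMap_eq R K L]
      exact (algebraMap K L).injective.comp (IsFractionRing.injective R K)
    refine hri.mono ?_
    rintro _ ⟨l, rfl⟩
    obtain ⟨r, hr⟩ := hcon (algebraMap R L l - θ) (isIntegral_algebraMap.sub hIntg)
    have h1 := congrArg τ hr
    rw [hfix, hr, map_prod] at h1
    simp only [Set.mem_ofPred_eq, Polynomial.eval_prod, Polynomial.eval_sub, Polynomial.eval_X, Polynomial.eval_C]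
    simpa [hfix] using h1.symm
  apply hU
  rw [Finset.eq_univ_iff_forall]
  intro ρ
  obtain ⟨σ₀, h0⟩ := hne
  have h3 := congrArg (Polynomial.eval (ρ θ)) (key (ρ * σ₀⁻¹))
  rw [Polynomial.eval_prod, Polynomial.eval_prod, Finset.prod_eq_zero h0] at h3
  · obtain ⟨σ, hσ, h4⟩ := Finset.prod_eq_zero_iff.1 h3.symm
    simp only [Polynomial.eval_sub, Polynomial.eval_X, Polynomial.eval_C] at h4
    rw [hinj ρ σ (sub_eq_zero.1 h4)]
    exact hσ
  · rw [← AlgEquiv.mul_apply, mul_assoc, inv_mul_cancel, mul_one]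
    simp

/-- elementary symmetric functions of the conjugates -/
noncomputable def ek (k : ℕ) (x : L) : L :=
  ∑ T ∈ Finset.powersetCard k (Finset.univ : Finset (L ≃ₐ[K] L)), ∏ σ ∈ T, σ x

omit [IsGalois K L] in
theorem ek_fixed (k : ℕ) (x : L) (τ : L ≃ₐ[K] L) : τ (ek (K := K) k x) = ek (K := K) k x := by
  classical
  unfold ek
  rw [map_sum]
  refine Finset.sum_equiv ((Equiv.mulLeft τ).finsetCongr) ?_ ?_
  · intro T
    simp [Finset.mem_powersetCard]
  · intro T hT
    rw [map_prod]
    simp [Finset.prod_map]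

theorem ek_mem (hv : ValExt R v g) (hR : QRing R t) (k : ℕ) {x : L} (hx : IsIntegral R x) :
    ∃ r : R, algebraMap R L r = ek (K := K) k x := by
  refine hv.inv_mem (K := K) hR ?_ (ek_fixed k x)
  unfold ek
  refine IsIntegral.sum _ fun T _ => IsIntegral.prod _ fun σ _ => int_map σ hx

/-- The main estimate: one contradiction step. -/
theorem core_step (hv : ValExt R v g) (hR : QRing R t) {U : Finset (L ≃ₐ[K] L)} (hne : U.Nonempty)
    {θ : L} (hθ : IsIntegral R θ) {C : ℕ}
    (hC : ∀ (n : ℕ) (F a : R), F ∉ maximalIdeal R ^ (n+1) →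
      ¬ v (algebraMap R L F * (∏ σ ∈ U, σ θ) - algebraMap R L a) ≤ g ^ (C * (n+1)))
    {x : L} (hx : IsIntegral R x) {s f : ℕ} (h1 : ∀ σ ∈ U, g ^ s < v (σ x))
    (h2 : ∀ σ, σ ∉ U → v (σ x) ≤ g ^ f) (hf : C * (U.card * s + 1) ≤ f) (hf' : U.card * s + 1 ≤ f) : False := by
  classical
  set k := U.card with hk
  obtain ⟨F, hF⟩ := ek_mem (K := K) hv hR k hx
  obtain ⟨a, ha⟩ := ek_mem (K := K) hv hR k (hx.mul hθ)
  have hUm : U ∈ Finset.powersetCard k (Finset.univ : Finset (L ≃ₐ[K] L)) := by simp [hk]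
  have hIntg : ∀ (y : L) (T : Finset (L ≃ₐ[K] L)), IsIntegral R y → v (∏ σ ∈ T, σ y) ≤ 1 := by
    intro y T hy
    exact hv.int _ (IsIntegral.prod _ fun σ _ => int_map σ hy)
  have hsmall : ∀ T ∈ (Finset.powersetCard k (Finset.univ : Finset (L ≃ₐ[K] L))).erase U,
      v (∏ σ ∈ T, σ x) ≤ g ^ f := by
    intro T hT
    obtain ⟨hTU, hT2⟩ := Finset.mem_erase.1 hT
    have hcard := (Finset.mem_powersetCard.1 hT2).2
    have : ¬ T ⊆ U := fun hsub => hTU (Finset.eq_of_subset_of_card_le hsub (by omega))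
    obtain ⟨σ, hσT, hσU⟩ := Finset.not_subset.1 this
    rw [← Finset.mul_prod_erase _ _ hσT, map_mul]
    exact (mul_le_of_le_one_right' (hIntg x _ hx)).trans (h2 σ hσU)
  have hbig : g ^ (k * s) ≤ v (∏ σ ∈ U, σ x) := by
    rw [map_prod, mul_comm, pow_mul, hk, ← Finset.prod_const]
    exact Finset.prod_le_prod' fun σ hσ => (h1 σ hσ).le
  have hFn : F ∉ maximalIdeal R ^ (k * s + 1) := by
    intro hmem
    rw [← hv.le_iff (v := v) hR, hF] at hmem
    have e : ∏ σ ∈ U, σ x = ek (K := K) k x -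
        ∑ T ∈ (Finset.powersetCard k (Finset.univ : Finset (L ≃ₐ[K] L))).erase U, ∏ σ ∈ T, σ x := by
      unfold ek
      rw [← Finset.add_sum_erase _ _ hUm]; ring
    have : v (∏ σ ∈ U, σ x) ≤ g ^ (k * s + 1) := by
      rw [e]
      refine v.map_sub_le hmem (v.map_sum_le fun T hT => (hsmall T hT).trans (hv.pow_le hf'))
    exact absurd (hbig.trans this) (not_le.2 (hv.pow_lt (by omega)))
  refine hC (k*s) F a hFn ?_
  rw [hF, ha]
  have e : ek (K := K) k x * (∏ σ ∈ U, σ θ) - ek (K := K) k (x * θ) =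
      ∑ T ∈ (Finset.powersetCard k (Finset.univ : Finset (L ≃ₐ[K] L))).erase U,
        (∏ σ ∈ T, σ x) * ((∏ σ ∈ U, σ θ) - (∏ σ ∈ T, σ θ)) := by
    have : ek (K := K) k x * (∏ σ ∈ U, σ θ) - ek (K := K) k (x * θ) =
      ∑ T ∈ (Finset.powersetCard k (Finset.univ : Finset (L ≃ₐ[K] L))),
        (∏ σ ∈ T, σ x) * ((∏ σ ∈ U, σ θ) - (∏ σ ∈ T, σ θ)) := by
      unfold ek
      rw [Finset.sum_mul, ← Finset.sum_sub_distrib]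
      refine Finset.sum_congr rfl fun T _ => ?_
      simp only [map_mul, Finset.prod_mul_distrib]
      ring
    rw [this, ← Finset.add_sum_erase _ _ hUm]; simp
  rw [e]
  refine v.map_sum_le fun T hT => ?_
  rw [map_mul]
  refine (mul_le_of_le_one_right' (v.map_sub_le (hIntg θ _ hθ) (hIntg θ _ hθ))).trans ?_
  exact (hsmall T hT).trans (hv.pow_le hf)

theorem core (hv : ValExt R v g) (hR : QRing R t) (hinf : Infinite R) :
    ∃ C : ℕ, ∀ (n : ℕ) (x y : L), IsIntegral R x → IsIntegral R y →
      (∃ σ : L ≃ₐ[K] L, g ^ n < v (σ x)) → (∃ σ : L ≃ₐ[K] L, g ^ n < v (σ y)) →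
      ∃ σ : L ≃ₐ[K] L, g ^ (C * (n+1)) < v (σ (x * y)) := by
  classical
  have hθ : ∀ U : Finset (L ≃ₐ[K] L), ∃ (θ : L) (C : ℕ), U.Nonempty → U ≠ Finset.univ →
      IsIntegral R θ ∧ ∀ (n : ℕ) (F a : R), F ∉ maximalIdeal R ^ (n+1) →
      ¬ v (algebraMap R L F * (∏ σ ∈ U, σ θ) - algebraMap R L a) ≤ g ^ (C * (n+1)) := by
    intro U
    by_cases h1 : U.Nonempty
    · by_cases h2 : U ≠ Finset.univ
      · obtain ⟨θ, h3, h4⟩ := exists_theta (R := R) hinf U h1 h2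
        obtain ⟨C, hC⟩ := hv.liouville hR (IsIntegral.prod _ fun σ _ => int_map σ h3) h4
        exact ⟨θ, C, fun _ _ => ⟨h3, hC⟩⟩
      · exact ⟨0, 0, fun _ h => absurd h h2⟩
    · exact ⟨0, 0, fun h => absurd h h1⟩
  choose θ Cf hθC using hθ
  set C0 := Finset.univ.sup Cf + 1 with hC0
  set D := Fintype.card (L ≃ₐ[K] L) with hD
  -- thresholds
  set f : ℕ → ℕ := fun s => C0 * (D * s + 1) with hf
  have hfle : ∀ i n, n ≤ f^[i] n := by
    intro i n
    induction i with
    | zero => simp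
    | succ i ih =>
      rw [Function.iterate_succ_apply']
      have hD1 : 1 ≤ D := Fintype.card_pos
      have h1 : 1 ≤ C0 := by omega
      calc n ≤ f^[i] n := ih
        _ ≤ 1 * (1 * f^[i] n + 1) := by omega
        _ ≤ C0 * (D * f^[i] n + 1) := by gcongr
  have hfb : ∀ i, ∃ c, ∀ n, f^[i] n ≤ c * (n+1) := by
    intro i
    induction i with
    | zero => exact ⟨1, fun n => by simp⟩
    | succ i ih =>
      obtain ⟨c, hc⟩ := ih
      refine ⟨C0 * (D * c + 1), fun n => ?_⟩
      rw [Function.iterate_succ_apply']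
      calc C0 * (D * f^[i] n + 1) ≤ C0 * (D * (c * (n+1)) + 1) := by gcongr; exact hc n
        _ ≤ C0 * (D * c + 1) * (n+1) := by nlinarith [Nat.zero_le (C0 * n)]
  have hfmono : ∀ n, Monotone fun i => f^[i] n := by
    intro n
    apply monotone_nat_of_le_succ
    intro i
    rw [show i + 1 = 1 + i by ring, Function.iterate_add_apply]
    exact hfle 1 _
  obtain ⟨c, hc⟩ := hfb (D + 1)
  refine ⟨c + 1, fun n x y hx hy ⟨σ₁, hσ₁⟩ ⟨σ₂, hσ₂⟩ => ?_⟩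
  by_contra! hcon
  set U : ℕ → Finset (L ≃ₐ[K] L) := fun i => Finset.univ.filter fun σ => g ^ (f^[i] n) < v (σ x) with hU
  have hUmono : ∀ i, U i ⊆ U (i+1) := by
    intro i σ hσ
    simp only [hU, Finset.mem_filter, Finset.mem_univ, true_and] at hσ ⊢
    exact lt_of_le_of_lt (hv.pow_le (hfmono n (Nat.le_succ i))) hσ
  have hUmono' : Monotone U := monotone_nat_of_le_succ hUmono
  have hUne : ∀ i, (U i).Nonempty := by
    intro i
    refine ⟨σ₁, hUmono' (Nat.zero_le i) ?_⟩
    simp only [hU, Finset.mem_filter, Finset.mem_univ, true_and]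
    exact hσ₁
  have hUuniv : ∀ i, i ≤ D + 1 → σ₂ ∉ U i := by
    intro i hi
    simp only [hU, Finset.mem_filter, Finset.mem_univ, true_and, not_lt]
    have h1 := hcon σ₂
    rw [map_mul, map_mul] at h1
    have h2 : f^[i] n ≤ c * (n+1) := (hfmono n hi).trans (hc n)
    have h3 : g ^ n * v (σ₂ x) ≤ g ^ n * g ^ (f^[i] n) := by
      calc g ^ n * v (σ₂ x) ≤ v (σ₂ x) * v (σ₂ y) := by
            rw [mul_comm]; exact mul_le_mul_right hσ₂.le _
        _ ≤ _ := h1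
        _ ≤ _ := by
          rw [← pow_add]
          apply hv.pow_le
          rw [add_mul]; omega
    exact le_of_mul_le_mul_left h3 (hv.pow_pos n)
  -- pigeonhole
  have hpig : ∃ i, i ≤ D ∧ U i = U (i+1) := by
    by_contra! hne
    have : ∀ i, i ≤ D + 1 → i ≤ (U i).card := by
      intro i
      induction i with
      | zero => simp
      | succ i ih =>
        intro hi
        have := Finset.card_lt_card (lt_of_le_of_ne (hUmono i) (hne i (by omega)))
        have := ih (by omega)
        omega
    have h1 := this (D+1) le_rfl
    have h2 : (U (D+1)).card ≤ D := Finset.card_le_univ _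
    omega
  obtain ⟨i, hi, hUi⟩ := hpig
  have hnu : U i ≠ Finset.univ := by
    intro h
    apply hUuniv i (by omega)
    rw [h]; simp
  obtain ⟨h3, h4⟩ := hθC (U i) (hUne i) hnu
  have hcd : (U i).card ≤ D := Finset.card_le_univ _
  have hCle : Cf (U i) ≤ C0 := (Finset.le_sup (f := Cf) (Finset.mem_univ (U i))).trans (Nat.le_succ _)
  refine core_step hv hR (hUne i) h3 h4 hx (s := f^[i] n) (f := f^[i+1] n) ?_ ?_ ?_ ?_
  · intro σ hσ
    simp only [hU, Finset.mem_filter, Finset.mem_univ, true_and] at hσ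
    exact hσ
  · intro σ hσ
    rw [hUi] at hσ
    simp only [hU, Finset.mem_filter, Finset.mem_univ, true_and, not_lt] at hσ
    exact hσ
  · rw [Function.iterate_succ_apply']
    simp only [hf]
    gcongr
  · rw [Function.iterate_succ_apply']
    have h1 : 1 ≤ C0 := by omega
    calc _ = 1 * ((U i).card * f^[i] n + 1) := by ring
      _ ≤ C0 * (D * f^[i] n + 1) := by gcongr

end
end Izumi


namespace Izumi

section
variable {R L ι : Type*} [CommRing R] [IsLocalRing R] [Field L] [Algebra R L] {t : ι → R}

/-- the local ring of the order valuation -/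
def ordSubring (hR : QRing R t) : Subring L where
  carrier := {z | ∃ (n : ℕ) (a b : R), a ∈ maximalIdeal R ^ n ∧ b ∈ maximalIdeal R ^ n ∧
    b ∉ maximalIdeal R ^ (n+1) ∧ z * algebraMap R L b = algebraMap R L a}
  mul_mem' := by
    rintro z w ⟨n, a, b, h1, h2, h3, h4⟩ ⟨n', a', b', h1', h2', h3', h4'⟩
    refine ⟨n + n', a * a', b * b', ?_, ?_, hR.mul_notMem h3 h3', ?_⟩
    · rw [pow_add]; exact Ideal.mul_mem_mul h1 h1'
    · rw [pow_add]; exact Ideal.mul_mem_mul h2 h2'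
    · rw [map_mul, map_mul, ← h4, ← h4']; ring
  one_mem' := ⟨0, 1, 1, by simp, by simp, by simp, by simp⟩
  add_mem' := by
    rintro z w ⟨n, a, b, h1, h2, h3, h4⟩ ⟨n', a', b', h1', h2', h3', h4'⟩
    refine ⟨n + n', a * b' + b * a', b * b', ?_, ?_, hR.mul_notMem h3 h3', ?_⟩
    · rw [pow_add]; exact Ideal.add_mem _ (Ideal.mul_mem_mul h1 h2') (Ideal.mul_mem_mul h2 h1')
    · rw [pow_add]; exact Ideal.mul_mem_mul h2 h2'
    · rw [map_mul, map_add, map_mul, map_mul, ← h4, ← h4']; ring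
  zero_mem' := ⟨0, 0, 1, by simp, by simp, by simp, by simp⟩
  neg_mem' := by
    rintro z ⟨n, a, b, h1, h2, h3, h4⟩
    exact ⟨n, -a, b, neg_mem h1, h2, h3, by rw [map_neg, ← h4]; ring⟩

theorem ordSubring_isLocal (hR : QRing R t) (hinj : Function.Injective (algebraMap R L)) :
    IsLocalRing (ordSubring (L := L) hR) := by
  have key : ∀ (z : ordSubring (L := L) hR) (n : ℕ) (a b : R), a ∈ maximalIdeal R ^ n →
      a ∉ maximalIdeal R ^ (n+1) → b ∈ maximalIdeal R ^ n → b ∉ maximalIdeal R ^ (n+1) →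
      (z : L) * algebraMap R L b = algebraMap R L a → IsUnit z := by
    intro z n a b h1 h2 h3 h4 h5
    have ha0 : algebraMap R L a ≠ 0 := by
      intro h
      rw [map_eq_zero_iff _ hinj] at h
      exact h2 (h ▸ zero_mem _)
    have hz0 : (z : L) ≠ 0 := by
      intro h; rw [h, zero_mul] at h5; exact ha0 h5.symm
    refine IsUnit.of_mul_eq_one ⟨(z : L)⁻¹, n, b, a, h3, h1, h2, ?_⟩ ?_
    · rw [← h5]; field_simp
    · ext; simp [hz0]
  refine IsLocalRing.of_isUnit_or_isUnit_one_sub_self fun z => ?_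
  obtain ⟨n, a, b, h1, h2, h3, h4⟩ := z.2
  by_cases ha : a ∈ maximalIdeal R ^ (n+1)
  · right
    refine key _ n (b - a) b (sub_mem h2 h1) (fun h => h3 ?_) h2 h3 ?_
    · have := add_mem h ha
      simpa using this
    · rw [map_sub, ← h4, AddSubgroupClass.coe_sub, OneMemClass.coe_one]; ring
  · left
    exact key z n a b h1 ha h2 h3 h4

theorem exists_valExt (hR : QRing R t) (hinj : Function.Injective (algebraMap R L))
    (halg : Algebra.IsAlgebraic R L) {π : R} (hπ : π ∈ maximalIdeal R)
    (hπ' : π ∉ maximalIdeal R ^ 2) :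
    ∃ (V : ValuationSubring L), ValExt R V.valuation (V.valuation (algebraMap R L π)) := by
  have hdom := hR.isDomain
  have := ordSubring_isLocal (L := L) hR hinj
  obtain ⟨V, hWV, hloc⟩ := LocalSubring.exists_le_valuationSubring (LocalSubring.mk (ordSubring (L := L) hR))
  have hW : ∀ z : L, z ∈ ordSubring (L := L) hR → V.valuation z ≤ 1 := fun z hz =>
    (V.valuation_le_one_iff z).2 (hWV hz)
  have hRW : ∀ r : R, algebraMap R L r ∈ ordSubring (L := L) hR := fun r =>
    ⟨0, r, 1, by simp, by simp, by simp, by simp⟩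
  have hπn : ∀ n : ℕ, π ^ n ∈ maximalIdeal R ^ n ∧ π ^ n ∉ maximalIdeal R ^ (n+1) := by
    intro n
    refine ⟨Ideal.pow_mem_pow hπ n, ?_⟩
    induction n with
    | zero => simp
    | succ n ih => rw [pow_succ π]; exact hR.mul_notMem ih (b := 1) hπ'
  have hne : ∀ r : R, r ≠ 0 → algebraMap R L r ≠ 0 := fun r hr h =>
    hr ((map_eq_zero_iff _ hinj).1 h)
  have hπ0 : π ≠ 0 := by rintro rfl; exact hπ' (zero_mem _)
  have hord : ∀ n (r : R), r ∈ maximalIdeal R ^ n → r ∉ maximalIdeal R ^ (n+1) →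
    V.valuation (algebraMap R L r) = (V.valuation (algebraMap R L π)) ^ n := by
    intro n r h1 h2
    have hr0 : r ≠ 0 := by rintro rfl; exact h2 (zero_mem _)
    have h3 := hW (algebraMap R L r / algebraMap R L (π ^ n)) ⟨n, r, π ^ n, h1, (hπn n).1, (hπn n).2, by
      have := hne _ (pow_ne_zero n hπ0); field_simp⟩
    have h4 := hW (algebraMap R L (π ^ n) / algebraMap R L r) ⟨n, π ^ n, r, (hπn n).1, h1, h2, by
      have := hne _ hr0; field_simp⟩
    rw [map_div₀, div_le_one₀ (zero_lt_iff.2 (by simpa using hne _ (pow_ne_zero n hπ0)))] at h3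
    rw [map_div₀, div_le_one₀ (zero_lt_iff.2 (by simpa using hne _ hr0))] at h4
    rw [← map_pow, ← map_pow]
    exact le_antisymm h3 h4
  have hg0 : V.valuation (algebraMap R L π) ≠ 0 := by
    rw [Valuation.ne_zero_iff]; exact hne _ hπ0
  have hIntg : ∀ z : L, IsIntegral R z → V.valuation z ≤ 1 := by
    rintro z ⟨p, hp, hpz⟩
    rw [V.valuation_le_one_iff]
    have hz : IsIntegral V z := by
      let f : R →+* V := (algebraMap R L).codRestrict V.toSubring (fun r => hWV (hRW r))
      refine ⟨p.map f, hp.map f, ?_⟩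
      rw [Polynomial.eval₂_map]
      exact hpz
    obtain ⟨y, hy⟩ := (IsIntegrallyClosed.isIntegral_iff (R := V) (K := L)).1 hz
    rw [← hy]; exact y.2
  refine ⟨V, hg0, ?_, hord, hIntg, ?_⟩
  · refine lt_of_le_of_ne (hW _ (hRW π)) fun h1 => ?_
    have hu : IsUnit (⟨algebraMap R L π, hWV (hRW π)⟩ : V) := (V.valuation_eq_one_iff _).2 h1
    have hu' : IsUnit (⟨algebraMap R L π, hRW π⟩ : ordSubring (L := L) hR) := hloc.map_nonunit _ hu
    obtain ⟨⟨w, n, a, b, h2, h3, h4, h5⟩, hw⟩ := hu'.exists_right_inv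
    have hw' : algebraMap R L π * w = 1 := congrArg Subtype.val hw
    apply h4
    have : b = π * a := by
      apply hinj
      rw [map_mul, ← h5, ← mul_assoc, hw', one_mul]
    rw [this, pow_succ']
    exact Ideal.mul_mem_mul hπ h2
  · intro z
    obtain ⟨b, hb, hbz⟩ := (halg.isAlgebraic z).exists_integral_multiple
    obtain ⟨m, hm, hm'⟩ := hR.exists_order hb
    refine ⟨m, ?_⟩
    rw [← hord m b hm hm', mul_comm, ← map_mul, ← Algebra.smul_def]
    exact hIntg _ hbz

theorem exists_pi (hR : QRing R t) (h : maximalIdeal R ≠ ⊥) :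
    ∃ π, π ∈ maximalIdeal R ∧ π ∉ maximalIdeal R ^ 2 := by
  by_contra! hcon
  apply h
  rw [eq_bot_iff]
  intro x hx
  have h2 : maximalIdeal R = maximalIdeal R ^ 2 := le_antisymm hcon (Ideal.pow_le_self two_ne_zero)
  apply hR.haus
  intro n
  have : ∀ n, maximalIdeal R ≤ maximalIdeal R ^ n := by
    intro n
    induction n with
    | zero => simp
    | succ n ih =>
      rcases n with _ | n
      · simp
      · calc maximalIdeal R ≤ maximalIdeal R ^ (n+1) := ih
          _ = maximalIdeal R ^ n * maximalIdeal R := pow_succ _ _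
          _ ≤ maximalIdeal R ^ n * maximalIdeal R ^ 2 := Ideal.mul_mono_right hcon
          _ = _ := by ring
  exact this n hx

theorem infinite_of [IsDomain R] (h : maximalIdeal R ≠ ⊥) : Infinite R := by
  rw [← not_finite_iff_infinite]
  intro hfin
  exact h ((IsLocalRing.isField_iff_maximalIdeal_eq).1 (Finite.isField_of_domain R))

end
end Izumi


namespace Izumi

/-- Artin-Rees for a finite module embedded in a free module. -/
theorem artinRees_pi {R M : Type*} [CommRing R] [IsNoetherianRing R] [AddCommGroup M] [Module R M]
    [Module.Finite R M] {ι : Type*} [Finite ι] (I : Ideal R) (Γ : M →ₗ[R] (ι → R))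
    (hΓ : Function.Injective Γ) :
    ∃ k : ℕ, ∀ (m : ℕ) (x : M), (∀ i, Γ x i ∈ I ^ (m + k)) → x ∈ (I ^ m • ⊤ : Submodule R M) := by
  classical
  have := Fintype.ofFinite ι
  obtain ⟨k, hk⟩ := Ideal.exists_pow_inf_eq_pow_smul I (LinearMap.range Γ)
  refine ⟨k, fun m x hx => ?_⟩
  have h1 : Γ x ∈ (I ^ (m+k) • ⊤ : Submodule R (ι → R)) := by
    have : Γ x = ∑ i, Γ x i • (Pi.single i (1 : R) : ι → R) := by
      ext j; simp [Pi.single_apply]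
    rw [this]
    exact Submodule.sum_mem _ fun i _ => Submodule.smul_mem_smul (hx i) trivial
  have h2 : Γ x ∈ (I ^ (m+k) • ⊤ ⊓ LinearMap.range Γ : Submodule R (ι → R)) := ⟨h1, x, rfl⟩
  rw [hk (m+k) (by omega), Nat.add_sub_cancel] at h2
  have h3 : Γ x ∈ (I ^ m • LinearMap.range Γ : Submodule R (ι → R)) :=
    Submodule.smul_mono le_rfl inf_le_right h2
  rw [LinearMap.range_eq_map, ← Submodule.map_smul''] at h3
  obtain ⟨y, hy, hxy⟩ := h3
  rwa [← hΓ hxy]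

/-- existence of Cartier maps -/
def Cart (R : Type*) [CommRing R] [IsLocalRing R] (q : ℕ) : Prop :=
  ∀ f : R, f ≠ 0 → ∃ π : R →+ R, (∀ r s, π (r ^ q * s) = r * π s) ∧
    (∃ c, ∀ m s, s ∈ maximalIdeal R ^ (q * m + c) → π s ∈ maximalIdeal R ^ m) ∧ π f ≠ 0

section
variable {R K L Γ ι A : Type*} [CommRing R] [IsDomain R] [IsLocalRing R] [IsNoetherianRing R]
    [Field K] [Field L] [Algebra R L]
    [Algebra R K] [Algebra K L] [IsScalarTower R K L] [IsFractionRing R K]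
    [FiniteDimensional K L] [IsGalois K L]
    [LinearOrderedCommGroupWithZero Γ] {v : Valuation L Γ} {g : Γ} {t : ι → R}
    [CommRing A] [Algebra R A] [Module.Finite R A]

omit [IsNoetherianRing R] in
theorem exists_trace_ne (z : L) (hz : z ≠ 0) : ∃ θ : L, IsIntegral R θ ∧
    ∑ σ : L ≃ₐ[K] L, σ (z * θ) ≠ 0 := by
  have hnd := traceForm_nondegenerate K L
  have : ∃ θ, Algebra.trace K L (z * θ) ≠ 0 := by
    by_contra! h
    exact hz (hnd.1 z fun θ => by rw [Algebra.traceForm_apply]; exact h θ)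
  obtain ⟨θ, hθ⟩ := this
  have hαR : IsAlgebraic R θ := (IsFractionRing.isAlgebraic_iff R K L).2 (Algebra.IsAlgebraic.isAlgebraic θ)
  obtain ⟨b, hb, hIntg⟩ := hαR.exists_integral_multiple
  refine ⟨b • θ, hIntg, ?_⟩
  rw [← trace_eq_sum_automorphisms]
  have e : z * b • θ = (algebraMap R K b) • (z * θ) := by
    rw [algebraMap_smul, mul_smul_comm]
  rw [e, map_smul]
  simpa [hb] using hθ

theorem exists_functional (hv : ValExt R v g) (hR : QRing R t) {q : ℕ} 
    (hcart : Cart R q) (ξ : A →+* L) (hξ : ∀ r : R, ξ (algebraMap R A r) = algebraMap R L r ^ q)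
    (hξint : ∀ a, IsIntegral R (ξ a)) (a : A) (ha : ξ a ≠ 0) :
    ∃ G : A →ₗ[R] R, G a ≠ 0 ∧ ∃ c, ∀ m x, (∀ σ : L ≃ₐ[K] L, v (σ (ξ x)) ≤ g ^ (q * m + c)) →
      G x ∈ maximalIdeal R ^ m := by
  obtain ⟨θ, hθ, hne⟩ := exists_trace_ne (R := R) (K := K) _ ha
  have hinj := hv.injective hR
  have hTint : ∀ x, ∃ r : R, algebraMap R L r = ∑ σ : L ≃ₐ[K] L, σ (ξ x * θ) := by
    intro x
    refine hv.inv_mem (K := K) hR (IsIntegral.sum _ fun σ _ => int_map σ ((hξint x).mul hθ)) ?_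
    intro τ
    rw [map_sum]
    exact Fintype.sum_equiv (Equiv.mulLeft τ) _ _ (fun σ => by simp)
  choose T hT using hTint
  have hTadd : ∀ x y, T (x + y) = T x + T y := by
    intro x y
    apply hinj
    rw [map_add, hT, hT, hT, ← Finset.sum_add_distrib]
    refine Finset.sum_congr rfl fun σ _ => ?_
    rw [map_add ξ, add_mul, map_add]
  have hTsmul : ∀ (r : R) x, T (r • x) = r ^ q * T x := by
    intro r x
    apply hinj
    rw [map_mul, hT, hT, Finset.mul_sum]
    refine Finset.sum_congr rfl fun σ _ => ?_
    rw [Algebra.smul_def, map_mul ξ, hξ, mul_assoc, map_mul σ, ← map_pow,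
      IsScalarTower.algebraMap_apply R K L, AlgEquiv.commutes]
  have hTa : T a ≠ 0 := by
    intro h
    apply hne
    rw [← hT, h, map_zero]
  obtain ⟨π, h1, ⟨c, hc⟩, h3⟩ := hcart (T a) hTa
  refine ⟨{ toFun := fun x => π (T x), map_add' := fun x y => by rw [hTadd, map_add],
            map_smul' := fun r x => by rw [hTsmul, h1]; rfl }, h3, c, fun m x hx => ?_⟩
  apply hc
  rw [← hv.le_iff (v := v) hR, hT]
  refine v.map_sum_le fun σ _ => ?_
  rw [map_mul, map_mul]
  exact (mul_le_of_le_one_right' (hv.int _ (int_map σ hθ))).trans (hx σ)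

theorem exists_bound (hv : ValExt R v g) (hR : QRing R t) {q : ℕ} 
    (hcart : Cart R q) (ξ : A →+* L) (hξ : ∀ r : R, ξ (algebraMap R A r) = algebraMap R L r ^ q)
    (hξint : ∀ a, IsIntegral R (ξ a)) (hξinj : Function.Injective ξ) :
    ∃ c, ∀ m x, (∀ σ : L ≃ₐ[K] L, v (σ (ξ x)) ≤ g ^ (q * m + c)) →
      x ∈ (maximalIdeal R ^ m • ⊤ : Submodule R A) := by
  set S : Set (A →ₗ[R] R) := {G | ∃ c, ∀ m x, (∀ σ : L ≃ₐ[K] L, v (σ (ξ x)) ≤ g ^ (q * m + c)) →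
      G x ∈ maximalIdeal R ^ m} with hS
  obtain ⟨s, hsS, hspan⟩ := (Submodule.fg_span_iff_fg_span_finset_subset S).1
    (IsNoetherian.noetherian (Submodule.span R S))
  have hs0 : ∀ x : A, (∀ G ∈ s, G x = 0) → x = 0 := by
    intro x hx
    by_contra hx0
    obtain ⟨G, hG, hGc⟩ := exists_functional (K := K) hv hR hcart ξ hξ hξint x
      (fun h => hx0 ((map_eq_zero_iff ξ hξinj).1 h))
    have hGm : G ∈ Submodule.span R (s : Set (A →ₗ[R] R)) := by
      rw [← hspan]; exact Submodule.subset_span hGc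
    apply hG
    clear hG hGc
    induction hGm using Submodule.span_induction with
    | mem y hy => exact hx y hy
    | zero => rfl
    | add y z _ _ hy hz => rw [LinearMap.add_apply, hy, hz, add_zero]
    | smul r y _ hy => rw [LinearMap.smul_apply, hy, smul_zero]
  obtain ⟨k, hk⟩ := artinRees_pi (maximalIdeal R) (LinearMap.pi fun G : s => (G : A →ₗ[R] R)) (by
    rw [injective_iff_map_eq_zero]
    intro x hx
    exact hs0 x fun G hG => congrFun hx ⟨G, hG⟩)
  choose cf hcf using fun G : s => hsS G.2
  refine ⟨q * k + Finset.univ.sup cf, fun m x hx => hk m x fun G => ?_⟩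
  apply hcf G
  intro σ
  refine (hx σ).trans (hv.pow_le ?_)
  have := Finset.le_sup (f := cf) (Finset.mem_univ G)
  rw [mul_add]; omega

include K in
theorem izumi_aux [IsLocalRing A] (hv : ValExt R v g) (hR : QRing R t) (hinf : Infinite R)
    {q : ℕ} (hq : 1 ≤ q) (φ : R →+* R) (hφ : ∀ r, φ r = r ^ q)
    (hcart : Cart R q) (ξ : A →+* L) (hξ : ∀ r : R, ξ (algebraMap R A r) = algebraMap R L r ^ q)
    (hξinj : Function.Injective ξ) (hloc : (maximalIdeal R).map (algebraMap R A) ≤ maximalIdeal A)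
    {e : ℕ} (he : maximalIdeal A ^ e ≤ (maximalIdeal R).map (algebraMap R A)) :
    ∃ C : ℕ, ∀ (n : ℕ) (x y : A), x ∉ maximalIdeal A ^ n → y ∉ maximalIdeal A ^ n →
      x * y ∉ maximalIdeal A ^ (C * (n+1)) := by
  have hξint : ∀ a, IsIntegral R (ξ a) := by
    intro a
    obtain ⟨p, hp, hpa⟩ := Algebra.IsIntegral.isIntegral (R := R) a
    refine ⟨p.map φ, hp.map φ, ?_⟩
    rw [Polynomial.eval₂_map]
    have h1 : (algebraMap R L).comp φ = ξ.comp (algebraMap R A) := by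
      ext r; simp [hφ, hξ]
    rw [h1, ← Polynomial.hom_eval₂, hpa, map_zero]
  obtain ⟨c, hc⟩ := exists_bound (K := K) hv hR hcart ξ hξ hξint hξinj
  obtain ⟨C, hC⟩ := core (K := K) hv hR hinf
  have hdown : ∀ n x, x ∉ maximalIdeal A ^ n → ∃ σ : L ≃ₐ[K] L, g ^ (q * n + c) < v (σ (ξ x)) := by
    intro n x hx
    by_contra! h
    apply hx
    have h1 := hc n x h
    rw [Ideal.smul_top_eq_map, Submodule.restrictScalars_mem, Ideal.map_pow] at h1
    exact Ideal.pow_right_mono hloc n h1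
  have hup : ∀ n x, x ∈ maximalIdeal A ^ (e * n) → ∀ σ : L ≃ₐ[K] L, v (σ (ξ x)) ≤ g ^ n := by
    intro n x hx σ
    rw [pow_mul] at hx
    have h1 := Ideal.pow_right_mono he n hx
    rw [← Ideal.map_pow] at h1
    refine Submodule.span_induction (p := fun x _ => v (σ (ξ x)) ≤ g ^ n) ?_ ?_ ?_ ?_ h1
    · rintro _ ⟨r, hr, rfl⟩
      rw [hξ, ← map_pow, IsScalarTower.algebraMap_apply R K L, AlgEquiv.commutes,
        ← IsScalarTower.algebraMap_apply, hv.le_iff hR]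
      exact Ideal.pow_mem_of_mem _ hr q hq
    · simp
    · intro x y _ _ hx hy
      rw [map_add, map_add]; exact v.map_add_le hx hy
    · intro a x _ hx
      rw [smul_eq_mul, map_mul, map_mul, map_mul]
      exact (mul_le_of_le_one_left' (hv.int _ (int_map σ (hξint a)))).trans hx
  refine ⟨e * (C * (q + c + 1)), fun n x y hx hy hxy => ?_⟩
  obtain ⟨σ, hσ⟩ := hC (q * n + c) (ξ x) (ξ y) (hξint x) (hξint y) (hdown n x hx) (hdown n y hy)
  rw [← map_mul] at hσ
  have h2 := hup (C * (q * n + c + 1)) (x * y) (Ideal.pow_le_pow_right (by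
    have : C * (q * n + c + 1) ≤ C * (q + c + 1) * (n+1) := by
      rw [mul_assoc]
      exact Nat.mul_le_mul_left _ (by nlinarith [Nat.zero_le (c*n)])
    calc _ ≤ e * (C * (q + c + 1) * (n+1)) := Nat.mul_le_mul_left _ this
      _ = _ := by ring) hxy) σ
  exact absurd h2 (not_le.2 hσ)

end
end Izumi

namespace Izumi

theorem exists_gal (K : Type*) (L₁ : Type u) [Field K] [Field L₁] [Algebra K L₁]
    [FiniteDimensional K L₁] (p : ℕ) [ExpChar K p] :
    ∃ (L : Type u) (_ : Field L) (_ : Algebra K L) (e : ℕ) (ξ : L₁ →+* L),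
      FiniteDimensional K L ∧ IsGalois K L ∧
      ∀ k, ξ (algebraMap K L₁ k) = algebraMap K L k ^ p ^ e := by
  let E := separableClosure K L₁
  let L := IntermediateField.normalClosure K E (SeparableClosure E)
  have : FiniteDimensional E L₁ := inferInstance
  have : ExpChar E p := expChar_of_injective_algebraMap (algebraMap K E).injective p
  have : IsPurelyInseparable.HasExponent E L₁ := IsPurelyInseparable.hasExponent_of_finiteDimensional
  have : Algebra.IsSeparable K (SeparableClosure E) := Algebra.IsSeparable.trans K E _
  have : IsSepClosure K (SeparableClosure E) := ⟨inferInstance, inferInstance⟩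
  refine ⟨L, inferInstance, inferInstance, IsPurelyInseparable.exponent E L₁,
    (algebraMap E L).comp (IsPurelyInseparable.iterateFrobenius E L₁ p le_rfl),
    ?_, ?_, ?_⟩
  · exact normalClosure.is_finiteDimensional K E (SeparableClosure E)
  · exact IsGalois.normalClosure K E (SeparableClosure E)
  · intro k
    rw [RingHom.comp_apply, IsScalarTower.algebraMap_apply K E L₁,
      IsPurelyInseparable.iterateFrobenius_algebraMap, map_pow,
      ← IsScalarTower.algebraMap_apply K E L]

theorem izumi_of_good {R : Type*} [CommRing R] [IsLocalRing R] [IsNoetherianRing R]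
    {ι : Type*} {t : ι → R} (hR : QRing R t) (hne : maximalIdeal R ≠ ⊥) (p : ℕ) [ExpChar R p]
    (hcart : ∀ e, Cart R (p ^ e)) {A : Type*} [CommRing A] [IsDomain A] [IsLocalRing A]
    [Algebra R A] [Module.Finite R A] (hinj : Function.Injective (algebraMap R A))
    (hloc : (maximalIdeal R).map (algebraMap R A) ≤ maximalIdeal A)
    {e : ℕ} (he : maximalIdeal A ^ e ≤ (maximalIdeal R).map (algebraMap R A)) :
    ∃ C : ℕ, ∀ (n : ℕ) (x y : A), x ∉ maximalIdeal A ^ n → y ∉ maximalIdeal A ^ n →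
      x * y ∉ maximalIdeal A ^ (C * (n+1)) := by
  have : IsDomain R := hR.isDomain
  let K := FractionRing R
  let L₁ := FractionRing A
  have : FaithfulSMul R A := (faithfulSMul_iff_algebraMap_injective R A).2 hinj
  have : FaithfulSMul R L₁ := (faithfulSMul_iff_algebraMap_injective R L₁).2 (by
    rw [IsScalarTower.algebraMap_eq R A L₁]
    exact (IsFractionRing.injective A L₁).comp hinj)
  let _ : Algebra K L₁ := FractionRing.liftAlgebra R L₁
  have : IsScalarTower R K L₁ := FractionRing.isScalarTower_liftAlgebra R L₁
  have : Algebra.IsIntegral R A := inferInstance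
  have : IsLocalization (Algebra.algebraMapSubmonoid A (nonZeroDivisors R)) L₁ := by
    rw [IsLocalization.iff_of_le_of_exists_dvd _ (nonZeroDivisors A) ?_ ?_]
    · infer_instance
    · rintro _ ⟨r, hr, rfl⟩
      rw [SetLike.mem_coe, mem_nonZeroDivisors_iff_ne_zero] at hr
      rw [mem_nonZeroDivisors_iff_ne_zero]
      exact fun h => hr (hinj (h.trans (map_zero _).symm))
    · intro a ha
      have h0 : IsAlgebraic R a := (Algebra.IsIntegral.isIntegral (R := R) a).isAlgebraic
      obtain ⟨r, hr, hd⟩ := h0.exists_nonzero_dvd ha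
      exact ⟨_, ⟨r, mem_nonZeroDivisors_iff_ne_zero.2 hr, rfl⟩, hd⟩
  have : FiniteDimensional K L₁ := .of_isLocalization R A (nonZeroDivisors R)
  have : ExpChar K p := expChar_of_injective_algebraMap (IsFractionRing.injective R K) p
  obtain ⟨L, _, _, e', ξ, h1, h2, h3⟩ := exists_gal K L₁ p
  let _ : Algebra R L := ((algebraMap K L).comp (algebraMap R K)).toAlgebra
  have : IsScalarTower R K L := .of_algebraMap_eq fun _ => rfl
  obtain ⟨π, hπ, hπ'⟩ := exists_pi hR hne
  have hinjL : Function.Injective (algebraMap R L) :=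
    (algebraMap K L).injective.comp (IsFractionRing.injective R K)
  have halg : Algebra.IsAlgebraic R L := by
    have : Algebra.IsAlgebraic K L := inferInstance
    exact (IsFractionRing.comap_isAlgebraic_iff (A := R) (K := K) (C := L)).2 inferInstance
  obtain ⟨V, hV⟩ := exists_valExt (L := L) hR hinjL halg hπ hπ'
  refine izumi_aux (K := K) hV hR (infinite_of hne) (q := p ^ e') ?_ (iterateFrobenius R p e')
    (fun r => iterateFrobenius_def ..) (hcart e') (ξ.comp (algebraMap A L₁)) ?_ ?_ hloc he
  · exact Nat.pos_of_ne_zero (expChar_pow_pos R p e').ne'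
  · intro r
    rw [RingHom.comp_apply, ← IsScalarTower.algebraMap_apply R A L₁,
      IsScalarTower.algebraMap_apply R K L₁, h3, IsScalarTower.algebraMap_apply R K L]
  · exact ξ.injective.comp (IsFractionRing.injective A L₁)

end Izumi

namespace Izumi
open PowerSeries

section PS
variable {R : Type*} [CommRing R] [IsLocalRing R]

theorem ps_mem_max {f : R⟦X⟧} : f ∈ maximalIdeal R⟦X⟧ ↔ constantCoeff f ∈ maximalIdeal R := by
  rw [mem_maximalIdeal, mem_maximalIdeal, mem_nonunits_iff, mem_nonunits_iff,
    isUnit_iff_constantCoeff]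

theorem ps_coeff_mem {n : ℕ} {f : R⟦X⟧} (hf : f ∈ maximalIdeal R⟦X⟧ ^ n) (j : ℕ) :
    coeff j f ∈ maximalIdeal R ^ (n - j) := by
  induction n generalizing f j with
  | zero => simp
  | succ n ih =>
    rw [pow_succ (maximalIdeal R⟦X⟧)] at hf
    induction hf using Submodule.mul_induction_on' generalizing j with
    | mem_mul_mem a ha b hb =>
      rw [coeff_mul]
      refine Ideal.sum_mem _ fun x hx => ?_
      rw [Finset.HasAntidiagonal.mem_antidiagonal] at hx
      rcases Nat.eq_zero_or_pos x.2 with h0 | h0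
      · have h1 : coeff x.2 b ∈ maximalIdeal R := by
          rw [h0, coeff_zero_eq_constantCoeff]; exact ps_mem_max.1 hb
        refine Ideal.pow_le_pow_right ?_ (pow_succ (maximalIdeal R) (n - x.1) ▸
          Ideal.mul_mem_mul (ih ha x.1) h1)
        omega
      · refine Ideal.mul_mem_right _ _ (Ideal.pow_le_pow_right ?_ (ih ha x.1))
        omega
    | add a _ b _ ha hb => rw [map_add]; exact Ideal.add_mem _ (ha j) (hb j)

theorem ps_X_mem : (X : R⟦X⟧) ∈ maximalIdeal R⟦X⟧ := by
  rw [ps_mem_max, constantCoeff_X]; exact Ideal.zero_mem _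

theorem ps_C_mem {n : ℕ} {r : R} (h : r ∈ maximalIdeal R ^ n) :
    (C r : R⟦X⟧) ∈ maximalIdeal R⟦X⟧ ^ n := by
  have h1 : (maximalIdeal R).map (C : R →+* R⟦X⟧) ≤ maximalIdeal R⟦X⟧ := by
    rw [Ideal.map_le_iff_le_comap]
    intro x hx
    rw [Ideal.mem_comap, ps_mem_max, constantCoeff_C]; exact hx
  refine Ideal.pow_right_mono h1 n ?_
  rw [← Ideal.map_pow]
  exact Ideal.mem_map_of_mem _ h

theorem ps_decomp (n : ℕ) (f : R⟦X⟧) :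
    ∃ g : R⟦X⟧, f = ∑ i ∈ Finset.range n, C (coeff i f) * X ^ i + X ^ n * g := by
  obtain ⟨g, hg⟩ := (X_pow_dvd_iff (n := n)
    (φ := f - ∑ i ∈ Finset.range n, C (coeff i f) * X ^ i)).2 (by
      intro m hm
      rw [map_sub, map_sum, sub_eq_zero]
      simp [coeff_C_mul, coeff_X_pow, hm])
  exact ⟨g, by rw [← hg]; ring⟩

theorem ps_mem {n : ℕ} {f : R⟦X⟧} (h : ∀ j, coeff j f ∈ maximalIdeal R ^ (n - j)) :
    f ∈ maximalIdeal R⟦X⟧ ^ n := by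
  obtain ⟨g, hg⟩ := ps_decomp n f
  rw [hg]
  refine Ideal.add_mem _ (Ideal.sum_mem _ fun i hi => ?_)
    (Ideal.mul_mem_right _ _ (Ideal.pow_mem_pow ps_X_mem n))
  rw [Finset.mem_range] at hi
  have := Ideal.mul_mem_mul (ps_C_mem (h i)) (Ideal.pow_mem_pow (ps_X_mem (R := R)) i)
  rw [← pow_add] at this
  refine Ideal.pow_le_pow_right ?_ this
  omega

theorem prod_mem_pow {ι : Type*} {t : ι → R} (ht : ∀ i, t i ∈ maximalIdeal R) (d : ι →₀ ℕ) :
    (d.prod fun i k => t i ^ k) ∈ maximalIdeal R ^ d.degree := by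
  classical
  induction d using Finsupp.induction with
  | zero => simp
  | single_add a b f ha hb ih =>
    rw [Finsupp.prod_add_index' (by simp) (by intros; rw [pow_add]), map_add, pow_add,
      Finsupp.prod_single_index (by simp), Finsupp.degree_single]
    exact Ideal.mul_mem_mul (Ideal.pow_mem_pow (ht a) b) ih

/-- the new parameter system. -/
noncomputable def psT {ι : Type*} (t : ι → R) : Option ι → R⟦X⟧ := fun o => o.elim X fun i => C (t i)

theorem degree_option {ι : Type*} (d : Option ι →₀ ℕ) : d.degree = d none + d.some.degree := by
  classical
  exact Finsupp.sum_option_index d (fun _ k => k) (fun _ => rfl) (fun _ _ _ => rfl)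

theorem ps_qring {ι : Type*} {t : ι → R} (hR : QRing R t) : QRing R⟦X⟧ (psT t) := by
  have ht : ∀ i, t i ∈ maximalIdeal R := fun i => by
    rw [← hR.span_eq]; exact Ideal.subset_span ⟨i, rfl⟩
  refine ⟨?_, ?_, ?_, ?_⟩
  · apply le_antisymm
    · rw [Ideal.span_le]
      rintro _ ⟨_ | i, rfl⟩
      · exact ps_X_mem
      · have := ps_C_mem (n := 1) (r := t i) (by simpa using ht i)
        rwa [pow_one] at this
    · intro f hf
      obtain ⟨g, hg⟩ := ps_decomp 1 f
      rw [hg]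
      refine Ideal.add_mem _ ?_ ?_
      · rw [Finset.sum_range_one, pow_zero, mul_one, coeff_zero_eq_constantCoeff]
        have h1 := ps_mem_max.1 hf
        rw [← hR.span_eq] at h1
        have h2 := Ideal.mem_map_of_mem (C : R →+* R⟦X⟧) h1
        rw [Ideal.map_span] at h2
        refine Ideal.span_mono ?_ h2
        rintro _ ⟨_, ⟨i, rfl⟩, rfl⟩
        exact ⟨some i, rfl⟩
      · rw [pow_one]
        exact Ideal.mul_mem_right _ _ (Ideal.subset_span ⟨none, rfl⟩)
  · intro n Φ hΦ hev d₀
    rw [ps_mem_max]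
    by_cases hd0 : Φ.coeff d₀ = 0
    · rw [hd0]; simp
    have hdeg : ∀ d ∈ Φ.support, d none + d.some.degree = n := fun d hd => by
      rw [← degree_option, Finsupp.degree_eq_weight_one]
      exact hΦ (MvPolynomial.mem_support_iff.1 hd)
    have hd0s := MvPolynomial.mem_support_iff.2 hd0
    set j := d₀ none with hj
    classical
    let Ψ : MvPolynomial ι R := ∑ d ∈ Φ.support.filter (fun d => d none = j),
      MvPolynomial.monomial d.some (constantCoeff (Φ.coeff d))
    have hjn : j ≤ n := by have := hdeg d₀ hd0s; omega
    have h1 : Ψ.IsHomogeneous (n - j) := by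
      refine MvPolynomial.IsHomogeneous.sum _ _ _ fun d hd => ?_
      rw [Finset.mem_filter] at hd
      refine MvPolynomial.isHomogeneous_monomial _ ?_
      have := hdeg d hd.1
      omega
    have h2 : MvPolynomial.eval t Ψ ∈ maximalIdeal R ^ (n - j + 1) := by
      have h3 := ps_coeff_mem hev j
      rw [show n + 1 - j = n - j + 1 by omega] at h3
      rw [MvPolynomial.eval_eq, map_sum] at h3
      have h5 : MvPolynomial.eval t Ψ = ∑ d ∈ Φ.support, if d none = j then
          constantCoeff (Φ.coeff d) * (d.some.prod fun i k => t i ^ k) else 0 := by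
        rw [← Finset.sum_filter, map_sum]
        exact Finset.sum_congr rfl fun d _ => MvPolynomial.eval_monomial
      rw [← Ideal.Quotient.eq_zero_iff_mem] at h3 ⊢
      rw [← h3, h5, Ideal.Quotient.mk_eq_mk_iff_sub_mem, ← Finset.sum_sub_distrib]
      refine Ideal.sum_mem _ fun d hd => ?_
      have h6 : (∏ i ∈ d.support, psT t i ^ d i) =
          X ^ (d none) * C (d.some.prod fun i k => t i ^ k) := by
        have := Finsupp.prod_option_index d (fun o k => psT t o ^ k) (by simp)
          (by intros; rw [pow_add])
        rw [Finsupp.prod] at this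
        rw [this, map_finsuppProd]
        simp [psT]
      have h7 := prod_mem_pow ht d.some
      have h8 := hdeg d hd
      rw [h6, mul_left_comm, coeff_X_pow_mul', coeff_mul_C]
      rcases lt_trichotomy (d none) j with h | h | h
      · rw [if_neg h.ne, if_pos h.le, zero_sub]
        refine Ideal.neg_mem_iff _ |>.2 (Ideal.mul_mem_left _ _ (Ideal.pow_le_pow_right ?_ h7))
        omega
      · rw [if_pos h, if_pos h.le, h, Nat.sub_self, coeff_zero_eq_constantCoeff, sub_self]
        exact Ideal.zero_mem _
      · rw [if_neg h.ne', if_neg (by omega), sub_self]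
        exact Ideal.zero_mem _
    have h4 := hR.qr _ Ψ h1 h2 d₀.some
    convert h4 using 1
    simp only [Ψ, MvPolynomial.coeff_sum, MvPolynomial.coeff_monomial]
    rw [Finset.sum_eq_single d₀]
    · simp
    · intro d hd hne
      rw [if_neg]
      intro h
      apply hne
      rw [Finset.mem_filter] at hd
      rw [← Finsupp.optionElim_some d, ← Finsupp.optionElim_some d₀, h, hd.2]
    · intro h; exact absurd (Finset.mem_filter.2 ⟨hd0s, hj.symm⟩) h
  · intro f hf
    have h1 : ∀ j, ∃ l, ∀ n, l - coeff j (f (n + j)) ∈ maximalIdeal R ^ n := fun j => by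
      refine hR.compl (fun n => coeff j (f (n + j))) fun n => ?_
      have := ps_coeff_mem (hf (n + j)) j
      rw [map_sub, Nat.add_sub_cancel] at this
      rwa [show n + 1 + j = n + j + 1 by ring]
    choose l hl using h1
    refine ⟨mk l, fun n => ps_mem fun j => ?_⟩
    rw [map_sub, coeff_mk]
    rcases le_total j n with h | h
    · have := hl j (n - j)
      rwa [Nat.sub_add_cancel h] at this
    · rw [Nat.sub_eq_zero_of_le h]; simp
  · intro f hf
    ext j
    refine hR.haus _ fun n => ?_
    have := ps_coeff_mem (hf (n + j)) j
    rwa [Nat.add_sub_cancel] at this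

end PS
end Izumi

namespace Izumi
open PowerSeries

theorem cart_one (R : Type*) [CommRing R] [IsLocalRing R] : Cart R 1 := by
  intro f hf
  refine ⟨AddMonoidHom.id R, fun r s => by simp, ⟨0, fun m s hs => by simpa using hs⟩, hf⟩

theorem ps_cart {R : Type*} [CommRing R] [IsLocalRing R] {p : ℕ} [hp : ExpChar R p] {e : ℕ}
    (h : Cart R (p ^ e)) : Cart R⟦X⟧ (p ^ e) := by
  intro f hf
  have hex : ∃ N, coeff N f ≠ 0 := by
    by_contra! h
    exact hf (PowerSeries.ext h)
  obtain ⟨N, hN⟩ := hex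
  obtain ⟨π, h1, ⟨c, h2⟩, h3⟩ := h _ hN
  have hE : ExpChar R⟦X⟧ p := expChar_of_injective_ringHom (C_injective (R := R)) p
  have hq : 0 < p ^ e := expChar_pow_pos R p e
  set q := p ^ e with hqd
  refine ⟨⟨⟨fun s => mk fun j => π (coeff (q * j + N % q) s), by ext; simp⟩,
    by intro a b; ext; simp⟩, ?_, ⟨c + q, ?_⟩, ?_⟩
  · intro r s
    ext j
    obtain ⟨g, hg⟩ := ps_decomp (j + 1) r
    have hr : r ^ q * s = ∑ i ∈ Finset.range (j+1), X ^ (i * q) * (C (coeff i r ^ q) * s) +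
        X ^ ((j + 1) * q) * (g ^ q * s) := by
      conv_lhs => rw [hg, hqd, add_pow_expChar_pow, sum_pow_char_pow, add_mul, Finset.sum_mul]
      congr 1
      · refine Finset.sum_congr rfl fun i _ => ?_
        rw [mul_pow, ← pow_mul, ← map_pow]; ring
      · rw [mul_pow, ← pow_mul]; ring
    have hlt := Nat.mod_lt N hq
    simp only [AddMonoidHom.coe_mk, ZeroHom.coe_mk, coeff_mk]
    rw [hr, map_add, map_sum, coeff_X_pow_mul' _ ((j+1)*q), if_neg (by
      rw [add_mul, mul_comm]; omega), add_zero, map_sum, coeff_mul,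
      Finset.Nat.sum_antidiagonal_eq_sum_range_succ
        (fun a b => coeff a r * coeff b (mk fun j => π (coeff (q * j + N % q) s)))]
    refine Finset.sum_congr rfl fun i hi => ?_
    rw [Finset.mem_range] at hi
    obtain ⟨k, rfl⟩ : ∃ k, j = i + k := ⟨j - i, by omega⟩
    rw [coeff_X_pow_mul', if_pos (by rw [mul_add, mul_comm]; omega), coeff_C_mul, h1,
      coeff_mk]
    congr 3
    rw [show i + k - i = k by omega, mul_add, mul_comm i q, add_assoc, Nat.add_sub_cancel_left]
  · intro m s hs
    refine ps_mem fun j => ?_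
    simp only [AddMonoidHom.coe_mk, ZeroHom.coe_mk, coeff_mk]
    have hlt := Nat.mod_lt N hq
    rcases le_total j m with h | h
    · apply h2
      refine Ideal.pow_le_pow_right ?_ (ps_coeff_mem hs _)
      obtain ⟨k, rfl⟩ := Nat.exists_eq_add_of_le h
      rw [Nat.add_sub_cancel_left, mul_add]; omega
    · rw [Nat.sub_eq_zero_of_le h]; simp
  · intro h0
    apply h3
    have := congrArg (coeff (N / q)) h0
    simpa [Nat.div_add_mod] using this

theorem field_cart (k : Type*) [Field k] (p : ℕ) [ExpChar k p] (e : ℕ) : Cart k (p ^ e) := by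
  intro f hf
  let φ := iterateFrobenius k p e
  have hφ : ∀ x, φ x = x ^ p ^ e := fun x => iterateFrobenius_def ..
  let K := φ.fieldRange
  obtain ⟨g, hg⟩ : ∃ g : Module.Dual K k, g f ≠ 0 := by
    by_contra! h
    exact hf ((Module.forall_dual_apply_eq_zero_iff K f).1 h)
  choose ψ hψ using fun y : K => y.2
  have hψ1 : ∀ y : K, ψ y ^ p ^ e = y := fun y => by rw [← hφ]; exact hψ y
  refine ⟨⟨⟨fun s => ψ (g s), ?_⟩, ?_⟩, ?_, ⟨1, ?_⟩, ?_⟩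
  · apply φ.injective; rw [hψ]; simp
  · intro a b; apply φ.injective; simp [hψ]
  · intro r s
    apply φ.injective
    simp only [AddMonoidHom.coe_mk, ZeroHom.coe_mk]
    rw [map_mul φ, hψ, hψ]
    have : r ^ p ^ e * s = (⟨φ r, ⟨r, rfl⟩⟩ : K) • s := by
      rw [← hφ]; rfl
    rw [this, map_smul]; rfl
  · intro m s hs
    have hs0 : s = 0 := by
      have : s ∈ maximalIdeal k := Ideal.pow_le_self (by omega) hs
      simpa [maximalIdeal_eq_bot] using this
    rw [hs0, map_zero]; exact Ideal.zero_mem _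
  · intro h
    apply hg
    have h1 := hψ (g f)
    simp only [AddMonoidHom.coe_mk, ZeroHom.coe_mk] at h
    rw [h, map_zero] at h1
    exact Subtype.ext h1.symm

theorem field_qring (k : Type*) [Field k] : QRing k (fun x : PEmpty.{1} => x.elim) := by
  have hbot : maximalIdeal k = ⊥ := maximalIdeal_eq_bot
  refine ⟨?_, ?_, ?_, ?_⟩
  · rw [hbot, Set.range_eq_empty, Ideal.span_empty]
  · intro n Φ hΦ hev d
    rcases n with _ | n
    · have h1 : Φ = MvPolynomial.C (MvPolynomial.coeff 0 Φ) := MvPolynomial.eq_C_of_isEmpty Φ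
      rw [h1, MvPolynomial.eval_C] at hev
      rw [Subsingleton.elim d 0]
      simpa using hev
    · by_contra h
      have h1 : MvPolynomial.coeff d Φ ≠ 0 := fun h0 => h (h0 ▸ Ideal.zero_mem _)
      have h2 := hΦ h1
      rw [Subsingleton.elim d 0] at h2
      simp at h2
  · intro f hf
    refine ⟨f 1, fun n => ?_⟩
    rcases n with _ | n
    · simp
    · have : f (n + 1) = f 1 := by
        induction n with
        | zero => rfl
        | succ n ih =>
          rw [← ih, ← sub_eq_zero]
          have := Ideal.pow_le_self (by omega) (hf (n + 1))
          simpa [hbot] using this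
      rw [this, sub_self]; exact Ideal.zero_mem _
  · intro x hx
    have := hx 1
    simpa [hbot] using this

theorem dvr_qring {D : Type*} [CommRing D] [IsDomain D] [IsLocalRing D] (ϖ : D) (h0 : ϖ ≠ 0)
    (hm : maximalIdeal D = Ideal.span {ϖ})
    (compl : ∀ f : ℕ → D, (∀ n, f (n+1) - f n ∈ maximalIdeal D ^ n) →
      ∃ l, ∀ n, l - f n ∈ maximalIdeal D ^ n)
    (haus : ∀ x : D, (∀ n, x ∈ maximalIdeal D ^ n) → x = 0) :
    QRing D (fun _ : Unit => ϖ) := by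
  refine ⟨by rw [hm, Set.range_const], ?_, compl, haus⟩
  intro n Φ hΦ hev d
  by_cases hd : d = Finsupp.single () n
  · have h1 : Φ = MvPolynomial.monomial (Finsupp.single () n) (Φ.coeff d) := by
      ext d'
      rw [MvPolynomial.coeff_monomial]
      split_ifs with h
      · rw [hd, h]
      · by_contra h2
        have h3 := hΦ h2
        apply h
        ext
        rw [← h3]
        simp [Finsupp.weight_apply, Finsupp.sum_fintype]
    rw [h1, MvPolynomial.eval_monomial, Finsupp.prod_single_index (by simp), hm,
      Ideal.span_singleton_pow, Ideal.mem_span_singleton] at hev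
    rw [hm, Ideal.mem_span_singleton]
    rw [pow_succ, mul_comm _ (ϖ ^ n)] at hev
    exact (mul_dvd_mul_iff_left (pow_ne_zero n h0)).1 hev
  · by_contra h
    have h1 : MvPolynomial.coeff d Φ ≠ 0 := fun h0 => h (h0 ▸ Ideal.zero_mem _)
    have h2 := hΦ h1
    apply hd
    ext
    rw [← h2]
    simp [Finsupp.weight_apply, Finsupp.sum_fintype]

end Izumi

namespace Izumi
open PowerSeries

section complete
variable {A : Type*} [CommRing A]

theorem adic_compl (I : Ideal A) [IsAdicComplete I A] (f : ℕ → A)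
    (hf : ∀ n, f (n+1) - f n ∈ I ^ n) : ∃ l, ∀ n, l - f n ∈ I ^ n := by
  have h1 : ∀ m k, f (m + k) - f m ∈ I ^ m := by
    intro m k
    induction k with
    | zero => simp
    | succ k ih =>
      have := Ideal.add_mem _ (Ideal.pow_le_pow_right (Nat.le_add_right m k) (hf (m + k))) ih
      rwa [sub_add_sub_cancel] at this
  obtain ⟨L, hL⟩ := IsPrecomplete.prec' (I := I) (M := A) f (by
    intro m n hmn
    obtain ⟨k, rfl⟩ := Nat.exists_eq_add_of_le hmn
    rw [SModEq.sub_mem, smul_eq_mul, Ideal.mul_top, ← neg_mem_iff, neg_sub]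
    exact h1 m k)
  refine ⟨L, fun n => ?_⟩
  have := hL n
  rw [SModEq.sub_mem, smul_eq_mul, Ideal.mul_top, ← neg_mem_iff, neg_sub] at this
  exact this

theorem adic_haus (I : Ideal A) [IsAdicComplete I A] (x : A) (hx : ∀ n, x ∈ I ^ n) : x = 0 := by
  refine IsHausdorff.haus' (I := I) x fun n => ?_
  rw [SModEq.sub_mem, smul_eq_mul, Ideal.mul_top, sub_zero]
  exact hx n

theorem eval₂_agree {R : Type*} [CommRing R] (I : Ideal A) (f : R →+* A) {x : A} (hx : x ∈ I)
    {n : ℕ} {P Q : Polynomial R} (h : ∀ d < n, P.coeff d = Q.coeff d) :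
    Ideal.Quotient.mk (I ^ n) (P.eval₂ f x) = Ideal.Quotient.mk (I ^ n) (Q.eval₂ f x) := by
  obtain ⟨S, hS⟩ := (Polynomial.X_pow_dvd_iff (n := n) (f := P - Q)).2
    (fun d hd => by rw [Polynomial.coeff_sub, h d hd, sub_self])
  rw [Ideal.Quotient.mk_eq_mk_iff_sub_mem, ← Polynomial.eval₂_sub, hS, Polynomial.eval₂_mul,
    Polynomial.eval₂_X_pow]
  exact Ideal.mul_mem_right _ _ (Ideal.pow_mem_pow hx n)

theorem ps_eval {R : Type*} [CommRing R] (I : Ideal A) [IsAdicComplete I A] (f : R →+* A) {x : A}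
    (hx : x ∈ I) : ∃ F : R⟦X⟧ →+* A, (∀ r, F (C r) = f r) ∧ F X = x := by
  have key : ∀ n (s s' : R⟦X⟧), Ideal.Quotient.mk (I ^ n) ((trunc n (s * s')).eval₂ f x) =
      Ideal.Quotient.mk (I ^ n) ((trunc n s).eval₂ f x) *
        Ideal.Quotient.mk (I ^ n) ((trunc n s').eval₂ f x) := by
    intro n s s'
    rw [← map_mul, ← Polynomial.eval₂_mul]
    refine eval₂_agree I f hx fun d hd => ?_
    rw [← trunc_trunc_mul_trunc, coeff_trunc, if_pos hd, ← Polynomial.coe_mul,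
      Polynomial.coeff_coe]
  let g : ∀ n, R⟦X⟧ →+* A ⧸ I ^ n := fun n =>
    { toFun := fun s => Ideal.Quotient.mk (I ^ n) ((trunc n s).eval₂ f x)
      map_one' := by
        rw [← map_one (Ideal.Quotient.mk (I ^ n)), ← Polynomial.eval₂_one f x]
        refine eval₂_agree I f hx fun d hd => ?_
        rw [coeff_trunc, if_pos hd, Polynomial.coeff_one, coeff_one]
      map_zero' := by simp
      map_add' := fun s s' => by rw [map_add, Polynomial.eval₂_add, map_add]
      map_mul' := key n }
  have hg : ∀ n s, g n s = Ideal.Quotient.mk (I ^ n) ((trunc n s).eval₂ f x) := fun _ _ => rfl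
  have hcomp : ∀ {m n : ℕ} (hle : m ≤ n), (Ideal.Quotient.factorPow I hle).comp (g n) = g m := by
    intro m n hle
    ext s
    rw [RingHom.comp_apply, hg, hg]
    change Ideal.Quotient.mk (I ^ m) _ = _
    refine eval₂_agree I f hx fun d hd => ?_
    rw [coeff_trunc, coeff_trunc, if_pos hd, if_pos (by omega)]
  have hF := IsAdicComplete.mk_liftRingHom I g hcomp
  refine ⟨IsAdicComplete.liftRingHom I g hcomp, fun r => ?_, ?_⟩
  · rw [← sub_eq_zero]
    refine adic_haus I _ fun n => ?_
    rw [← Ideal.Quotient.mk_eq_mk_iff_sub_mem, hF, hg, ← Polynomial.eval₂_C f x]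
    refine eval₂_agree I f hx fun d hd => ?_
    rw [coeff_trunc, if_pos hd, Polynomial.coeff_C, coeff_C]
  · rw [← sub_eq_zero]
    refine adic_haus I _ fun n => ?_
    rw [← Ideal.Quotient.mk_eq_mk_iff_sub_mem, hF, hg]
    conv_rhs => rw [← Polynomial.eval₂_X f x]
    refine eval₂_agree I f hx fun d hd => ?_
    rw [coeff_trunc, if_pos hd, Polynomial.coeff_X, coeff_X]
    simp [eq_comm]

end complete

/-- a good power series ring maps to `A`, with parameters generating `I`. -/
def HasGood (A : Type u) [CommRing A] [IsLocalRing A] (p : ℕ) (I : Ideal A) (n : ℕ) : Prop :=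
  ∃ (R : Type u) (_ : CommRing R) (_ : IsLocalRing R) (ι : Type) (_ : Fintype ι) (t : ι → R)
    (f : R →+* A), IsNoetherianRing R ∧ QRing R t ∧ Fintype.card ι = n ∧ ExpChar R p ∧
    (∀ e, Cart R (p ^ e)) ∧ (maximalIdeal R).map f = I ∧ (∀ a, ∃ r, a - f r ∈ maximalIdeal A)

theorem HasGood.step {A : Type u} [CommRing A] [IsLocalRing A] [IsAdicComplete (maximalIdeal A) A]
    {p : ℕ} {I : Ideal A} {n : ℕ} (h : HasGood A p I n) {x : A} (hx : x ∈ maximalIdeal A) :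
    HasGood A p (I ⊔ Ideal.span {x}) (n + 1) := by
  obtain ⟨R, _, _, ι, _, t, f, hN, hQ, hc, hE, hC, hI, hs⟩ := h
  obtain ⟨F, hF, hFX⟩ := ps_eval (maximalIdeal A) f hx
  refine ⟨R⟦X⟧, inferInstance, inferInstance, Option ι, inferInstance, psT t, F, inferInstance,
    ps_qring hQ, by rw [Fintype.card_option, hc],
    expChar_of_injective_ringHom (C_injective (R := R)) p, fun e => ps_cart (hC e), ?_, ?_⟩
  · rw [← (ps_qring hQ).span_eq, ← hI, ← hQ.span_eq, Ideal.map_span, Ideal.map_span,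
      ← Ideal.span_union]
    congr 1
    ext y
    constructor
    · rintro ⟨_, ⟨_ | i, rfl⟩, rfl⟩
      · exact Or.inr hFX
      · exact Or.inl ⟨t i, ⟨i, rfl⟩, (hF _).symm⟩
    · rintro (⟨_, ⟨i, rfl⟩, rfl⟩ | h)
      · exact ⟨_, ⟨some i, rfl⟩, hF _⟩
      · exact ⟨_, ⟨none, rfl⟩, hFX.trans h.symm⟩
  · intro a
    obtain ⟨r, hr⟩ := hs a
    exact ⟨C r, by rwa [hF]⟩

theorem HasGood.list {A : Type u} [CommRing A] [IsLocalRing A] [IsAdicComplete (maximalIdeal A) A]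
    {p : ℕ} {I : Ideal A} {n : ℕ} (h : HasGood A p I n) (s : Finset A)
    (hs : ∀ x ∈ s, x ∈ maximalIdeal A) :
    HasGood A p (I ⊔ Ideal.span (s : Set A)) (n + s.card) := by
  classical
  induction s using Finset.induction_on with
  | empty => simpa using h
  | insert a s ha ih =>
    have := (ih fun x hx => hs x (Finset.mem_insert_of_mem hx)).step
      (hs a (Finset.mem_insert_self _ _))
    rw [Finset.card_insert_of_notMem ha, Finset.coe_insert, Ideal.span_insert,
      sup_comm (Ideal.span {a}), ← sup_assoc]
    exact this

end Izumi

namespace Izumi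

theorem dim_le_of_integral (R S : Type*) [CommRing R] [CommRing S] [Algebra R S]
    [Algebra.IsIntegral R S] : ringKrullDim S ≤ ringKrullDim R := by
  refine Order.krullDim_le_of_strictMono (PrimeSpectrum.comap (algebraMap R S)) ?_
  intro a b hab
  exact Ideal.IsIntegral.comap_lt_comap (R := R) (I := a.asIdeal) (J := b.asIdeal) hab

section
variable {R A : Type*} [CommRing R] [IsLocalRing R] {ι : Type*} {t : ι → R}
  [CommRing A] [IsLocalRing A] [IsNoetherianRing A] [Algebra R A]

theorem exists_fg_approx
    (hs : ∀ a : A, ∃ r : R, a - algebraMap R A r ∈ maximalIdeal A) (i : ℕ) :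
    ∃ M : Submodule R A, M.FG ∧ ∀ a, ∃ m ∈ M, a - m ∈ maximalIdeal A ^ i := by
  induction i with
  | zero => exact ⟨⊥, Submodule.fg_bot, fun a => ⟨0, Submodule.zero_mem _, by simp⟩⟩
  | succ i ih =>
    obtain ⟨M, hM, h⟩ := ih
    obtain ⟨G, hG⟩ := (isNoetherianRing_iff_ideal_fg A).1 inferInstance (maximalIdeal A ^ i)
    have hle : ∀ m ∈ Submodule.span R (G : Set A), m ∈ maximalIdeal A ^ i := by
      intro m hm
      rw [← hG]
      exact Submodule.span_le_restrictScalars R A (G : Set A) hm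
    refine ⟨M ⊔ Submodule.span R (G : Set A), hM.sup ⟨G, rfl⟩, fun a => ?_⟩
    obtain ⟨m, hm, ham⟩ := h a
    suffices H : ∃ m' ∈ Submodule.span R (G : Set A), a - m - m' ∈ maximalIdeal A ^ (i+1) by
      obtain ⟨m', hm', h'⟩ := H
      exact ⟨m + m', Submodule.add_mem_sup hm hm', by rwa [← sub_sub]⟩
    rw [← hG] at ham
    generalize a - m = y at ham
    induction ham using Submodule.span_induction with
    | mem x hx => exact ⟨x, Submodule.subset_span hx, by simp⟩
    | zero => exact ⟨0, Submodule.zero_mem _, by simp⟩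
    | add x y _ _ hx hy =>
      obtain ⟨m1, h1, h1'⟩ := hx
      obtain ⟨m2, h2, h2'⟩ := hy
      refine ⟨m1 + m2, Submodule.add_mem _ h1 h2, ?_⟩
      have := Ideal.add_mem _ h1' h2'
      rwa [show x + y - (m1 + m2) = x - m1 + (y - m2) by ring]
    | smul b x _ hx =>
      obtain ⟨m1, h1, h1'⟩ := hx
      obtain ⟨r, hr⟩ := hs b
      refine ⟨r • m1, Submodule.smul_mem _ _ h1, ?_⟩
      rw [smul_eq_mul, Algebra.smul_def, show b * x - algebraMap R A r * m1 =
        b * (x - m1) + (b - algebraMap R A r) * m1 by ring]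
      refine Ideal.add_mem _ (Ideal.mul_mem_left _ _ h1') ?_
      rw [pow_succ' (maximalIdeal A)]
      exact Ideal.mul_mem_mul hr (hle _ h1)

theorem finite_of_complete (hR : QRing R t)
    (hloc : (maximalIdeal R).map (algebraMap R A) ≤ maximalIdeal A)
    {e : ℕ} (he : maximalIdeal A ^ e ≤ (maximalIdeal R).map (algebraMap R A))
    (hs : ∀ a : A, ∃ r : R, a - algebraMap R A r ∈ maximalIdeal A) : Module.Finite R A := by
  obtain ⟨M, hM, h⟩ := exists_fg_approx hs e
  have : Module.Finite R M := Module.Finite.iff_fg.2 hM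
  obtain ⟨n, g, hg⟩ := Module.Finite.exists_fin' R M
  have hpre : IsPrecomplete (maximalIdeal R) (Fin n → R) := by
    refine ⟨fun f hf => ?_⟩
    have h1 : ∀ i, ∃ l, ∀ n, l - f n i ∈ maximalIdeal R ^ n := by
      intro i
      refine hR.compl (fun k => f k i) fun k => ?_
      have h2 := hf (Nat.le_succ k)
      rw [SModEq.sub_mem] at h2
      have h3 : ∀ x ∈ (maximalIdeal R ^ k • ⊤ : Submodule R (Fin n → R)),
          x i ∈ maximalIdeal R ^ k := by
        intro x hx
        refine Submodule.smul_induction_on hx ?_ ?_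
        · intro r hr y _
          exact Ideal.mul_mem_right _ _ hr
        · intro x y hx hy
          exact Ideal.add_mem _ hx hy
      have h4 := neg_mem (h3 _ h2)
      rwa [Pi.sub_apply, neg_sub] at h4
    choose l hl using h1
    refine ⟨l, fun n => ?_⟩
    rw [SModEq.sub_mem, ← neg_mem_iff, neg_sub]
    have : l - f n = ∑ i, (l i - f n i) • (Pi.single i (1 : R) : Fin _ → R) := by
      ext j; simp [Pi.single_apply]
    rw [this]
    exact Submodule.sum_mem _ fun i _ => Submodule.smul_mem_smul (hl i n) trivial
  have hhaus : IsHausdorff (maximalIdeal R) A := by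
    refine ⟨fun x hx => ?_⟩
    have h1 : x ∈ ⨅ n, maximalIdeal A ^ n := by
      rw [Ideal.mem_iInf]
      intro n
      have := hx n
      rw [SModEq.sub_mem, sub_zero, Ideal.smul_top_eq_map, Ideal.map_pow] at this
      exact Ideal.pow_right_mono hloc n this
    rwa [Ideal.iInf_pow_eq_bot_of_isLocalRing _ Ideal.IsPrime.ne_top'] at h1
  refine Module.Finite.of_surjective (M.subtype ∘ₗ g)
    (surjective_of_mkQ_comp_surjective (I := maximalIdeal R) ?_)
  intro y
  obtain ⟨a, rfl⟩ := Submodule.mkQ_surjective _ y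
  obtain ⟨m, hm, ham⟩ := h a
  obtain ⟨x, hx⟩ := hg ⟨m, hm⟩
  refine ⟨x, ?_⟩
  simp only [LinearMap.comp_apply, hx, Submodule.subtype_apply]
  rw [Submodule.mkQ_apply, Submodule.mkQ_apply, eq_comm, Submodule.Quotient.eq,
    Ideal.smul_top_eq_map]
  exact he ham

theorem injective_of_dim [IsNoetherianRing R] [Fintype ι] (hR : QRing R t) [Module.Finite R A]
    (hdim : ringKrullDim A = Fintype.card ι) : Function.Injective (algebraMap R A) := by
  have := hR.isDomain
  rw [injective_iff_map_eq_zero]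
  intro r hr
  by_contra hne
  have h1 := ringKrullDim_quotient_succ_le_of_nonZeroDivisor (mem_nonZeroDivisors_of_ne_zero hne)
  let φ : R ⧸ Ideal.span {r} →+* A := Ideal.Quotient.lift _ (algebraMap R A) (by
    intro x hx
    obtain ⟨c, rfl⟩ := Ideal.mem_span_singleton'.1 hx
    rw [map_mul, hr, mul_zero])
  let _ : Algebra (R ⧸ Ideal.span {r}) A := φ.toAlgebra
  have : IsScalarTower R (R ⧸ Ideal.span {r}) A := .of_algebraMap_eq fun _ => rfl
  have : Algebra.IsIntegral (R ⧸ Ideal.span {r}) A := Algebra.IsIntegral.tower_top R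
  have h2 := dim_le_of_integral (R ⧸ Ideal.span {r}) A
  have h3 := ringKrullDim_le_spanFinrank_maximalIdeal R
  have h4 : (maximalIdeal R).spanFinrank ≤ Fintype.card ι := by
    rw [← hR.span_eq]
    refine (Submodule.spanFinrank_span_le_ncard_of_finite (Set.finite_range t)).trans ?_
    rw [← Set.image_univ, ← Nat.card_eq_fintype_card, ← Set.ncard_univ]
    exact Set.ncard_image_le
  have h5 : ringKrullDim A + 1 ≤ Fintype.card ι :=
    (add_le_add_left h2 1).trans (h1.trans (h3.trans (by exact_mod_cast h4)))
  rw [hdim] at h5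
  norm_cast at h5
  omega

end

theorem izumi_of_hasGood {A : Type u} [CommRing A] [IsDomain A] [IsLocalRing A] [IsNoetherianRing A]
    (hne : maximalIdeal A ≠ ⊥) {p n : ℕ} {I : Ideal A} (h : HasGood A p I n)
    (hI : I ≤ maximalIdeal A) {e : ℕ} (he : maximalIdeal A ^ e ≤ I) (hdim : ringKrullDim A = n) :
    ∃ C : ℕ, ∀ (n : ℕ) (x y : A), x ∉ maximalIdeal A ^ n → y ∉ maximalIdeal A ^ n →
      x * y ∉ maximalIdeal A ^ (C * (n+1)) := by
  obtain ⟨R, _, _, ι, _, t, f, hN, hQ, hc, hE, hC, hI', hs⟩ := h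
  subst hI'
  let _ : Algebra R A := f.toAlgebra
  have hfin : Module.Finite R A := finite_of_complete hQ hI he hs
  subst hc
  refine izumi_of_good hQ ?_ p hC (injective_of_dim hQ hdim) hI he
  intro h0
  rw [h0, Ideal.map_bot, le_bot_iff] at he
  rw [← Ideal.zero_eq_bot] at he
  exact hne (eq_zero_of_pow_eq_zero he)

end Izumi

namespace Izumi

theorem exists_sop (B : Type*) [CommRing B] [IsLocalRing B] [IsNoetherianRing B] :
    ∃ s : Finset B, (∀ x ∈ s, x ∈ maximalIdeal B) ∧ ringKrullDim B = s.card ∧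
      ∃ e : ℕ, maximalIdeal B ^ e ≤ Ideal.span (s : Set B) := by
  obtain ⟨s, hs, hc⟩ := Ideal.exists_finset_card_eq_height_of_isNoetherianRing (maximalIdeal B)
  refine ⟨s, fun x hx => hs.1.2 (Ideal.subset_span hx), ?_, ?_⟩
  · rw [← IsLocalRing.maximalIdeal_height_eq_ringKrullDim, ← hc]; rfl
  · have hrad : (Ideal.span (s : Set B)).radical = maximalIdeal B := by
      apply le_antisymm
      · exact (Ideal.IsPrime.radical_le_iff inferInstance).2 hs.1.2
      · rw [Ideal.radical_eq_sInf]
        refine le_sInf ?_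
        rintro P ⟨hP, hPp⟩
        exact hs.2 ⟨hPp, hP⟩ (le_maximalIdeal hPp.ne_top)
    obtain ⟨n, hn⟩ := Ideal.exists_radical_pow_le_of_fg (Ideal.span (s : Set B))
      (IsNoetherian.noetherian _)
    exact ⟨n, hrad ▸ hn⟩

theorem izumi_equal {A : Type u} [CommRing A] [IsDomain A] [IsLocalRing A] [IsNoetherianRing A]
    [IsAdicComplete (maximalIdeal A) A]
    (hne : maximalIdeal A ≠ ⊥) {p : ℕ} (h : HasGood A p ⊥ 0) :
    ∃ C : ℕ, ∀ (n : ℕ) (x y : A), x ∉ maximalIdeal A ^ n → y ∉ maximalIdeal A ^ n →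
      x * y ∉ maximalIdeal A ^ (C * (n+1)) := by
  obtain ⟨s, hs, hc, e, he⟩ := exists_sop A
  have h2 := h.list s hs
  rw [bot_sup_eq, zero_add] at h2
  exact izumi_of_hasGood hne h2 (Ideal.span_le.2 hs) he hc

theorem izumi_mixed {A : Type u} [CommRing A] [IsDomain A] [IsLocalRing A] [IsNoetherianRing A]
    [IsAdicComplete (maximalIdeal A) A] {q : A} (hq : q ∈ maximalIdeal A) (hq0 : q ≠ 0)
    (h : HasGood A 1 (Ideal.span {q}) 1) :
    ∃ C : ℕ, ∀ (n : ℕ) (x y : A), x ∉ maximalIdeal A ^ n → y ∉ maximalIdeal A ^ n →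
      x * y ∉ maximalIdeal A ^ (C * (n+1)) := by
  classical
  have hle : Ideal.span {q} ≤ maximalIdeal A := by
    rw [Ideal.span_le, Set.singleton_subset_iff]; exact hq
  have : Nontrivial (A ⧸ Ideal.span {q}) :=
    Ideal.Quotient.nontrivial_iff.2 fun h => Ideal.IsPrime.ne_top' (top_le_iff.1 (h ▸ hle))
  have : IsLocalRing (A ⧸ Ideal.span {q}) :=
    IsLocalRing.of_surjective' (Ideal.Quotient.mk _) Ideal.Quotient.mk_surjective
  obtain ⟨s, hs, hc, e, he⟩ := exists_sop (A ⧸ Ideal.span {q})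
  let g := Function.surjInv (Ideal.Quotient.mk_surjective (I := Ideal.span {q}))
  have hg : ∀ x, Ideal.Quotient.mk _ (g x) = x := Function.surjInv_eq _
  have hginj : Function.Injective g := Function.injective_surjInv _
  have hmem : ∀ x, Ideal.Quotient.mk (Ideal.span {q}) x ∈ maximalIdeal _ ↔ x ∈ maximalIdeal A := by
    intro x
    constructor
    · intro h1 h2
      exact h1 (h2.map _)
    · intro h1 h2
      obtain ⟨y, hy⟩ := h2.exists_right_inv
      obtain ⟨y, rfl⟩ := Ideal.Quotient.mk_surjective y
      rw [← map_mul, ← map_one (Ideal.Quotient.mk _), Ideal.Quotient.mk_eq_mk_iff_sub_mem] at hy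
      have h3 := Ideal.sub_mem _ (Ideal.mul_mem_right y _ h1) (hle hy)
      rw [sub_sub_cancel] at h3
      exact (Ideal.ne_top_iff_one _).1 Ideal.IsPrime.ne_top' h3
  have hs' : ∀ x ∈ s.image g, x ∈ maximalIdeal A := by
    intro x hx
    obtain ⟨y, hy, rfl⟩ := Finset.mem_image.1 hx
    rw [← hmem, hg]
    exact hs y hy
  have h2 := h.list (s.image g) hs'
  rw [Finset.card_image_of_injective _ hginj] at h2
  refine izumi_of_hasGood (e := e) ?_ h2 (sup_le hle (Ideal.span_le.2 hs')) ?_ ?_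
  · rintro h0
    rw [h0] at hq
    exact hq0 hq
  · have h3 : Ideal.map (Ideal.Quotient.mk (Ideal.span {q})) (maximalIdeal A ^ e) ≤
        Ideal.map (Ideal.Quotient.mk (Ideal.span {q})) (Ideal.span (s.image g : Finset A)) := by
      rw [Ideal.map_pow, Ideal.map_span, Finset.coe_image, ← Set.image_comp]
      have : (Ideal.Quotient.mk (Ideal.span {q})) ∘ g = id := funext hg
      rw [this, Set.image_id]
      refine le_trans (Ideal.pow_right_mono ?_ e) he
      rw [Ideal.map_le_iff_le_comap]
      exact fun x hx => (hmem x).2 hx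
    rw [Ideal.map_le_iff_le_comap, Ideal.comap_map_of_surjective _ Ideal.Quotient.mk_surjective,
      ← RingHom.ker_eq_comap_bot, Ideal.mk_ker] at h3
    rwa [sup_comm]
  · have := ringKrullDim_quotient_span_singleton_succ_eq_ringKrullDim_of_mem_nonZeroDivisors
      (mem_nonZeroDivisors_of_ne_zero hq0) hq
    rw [← this, hc, add_comm]; norm_cast

end Izumi

namespace Izumi

section
variable {A : Type*} [CommRing A] [IsLocalRing A]

/-- closed subrings surjecting onto the residue field -/
def IsCoef (S : Subring A) : Prop :=
  (∀ a, (∀ n, ∃ s ∈ S, a - s ∈ maximalIdeal A ^ n) → a ∈ S) ∧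
    ∀ a, ∃ s ∈ S, a - s ∈ maximalIdeal A

theorem wf_quot [IsNoetherianRing A] (n : ℕ) (F : Set (Ideal A)) (hF : F.Nonempty)
    (hle : ∀ J ∈ F, maximalIdeal A ^ n ≤ J) : ∃ J ∈ F, ∀ K ∈ F, K ≤ J → K = J := by
  by_cases hn : n = 0
  · subst hn
    obtain ⟨J, hJ⟩ := hF
    refine ⟨J, hJ, fun K hK _ => ?_⟩
    have h1 := hle J hJ
    have h2 := hle K hK
    rw [pow_zero, Ideal.one_eq_top, top_le_iff] at h1 h2
    rw [h1, h2]
  set Q := A ⧸ maximalIdeal A ^ n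
  have hne : maximalIdeal A ^ n ≠ ⊤ := by
    intro h
    exact Ideal.IsPrime.ne_top' (top_le_iff.1 (h ▸ Ideal.pow_le_self hn))
  have : Nontrivial Q := Ideal.Quotient.nontrivial_iff.2 hne
  have : IsLocalRing Q :=
    IsLocalRing.of_surjective' (Ideal.Quotient.mk _) Ideal.Quotient.mk_surjective
  have : IsArtinianRing Q := by
    rw [isArtinianRing_iff_isNilpotent_maximalIdeal]
    refine ⟨n, ?_⟩
    rw [← IsLocalRing.map_maximalIdeal_of_surjective (Ideal.Quotient.mk (maximalIdeal A ^ n))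
      Ideal.Quotient.mk_surjective, ← Ideal.map_pow, Ideal.map_quotient_self]
    rfl
  obtain ⟨J', ⟨J, hJ, rfl⟩, hmin⟩ := (wellFounded_lt (α := Ideal Q)).has_min
    (Set.image (Ideal.map (Ideal.Quotient.mk (maximalIdeal A ^ n))) F) (hF.image _)
  refine ⟨J, hJ, fun K hK hKJ => ?_⟩
  have h1 := hmin _ ⟨K, hK, rfl⟩
  have h2 : Ideal.map (Ideal.Quotient.mk (maximalIdeal A ^ n)) K =
      Ideal.map (Ideal.Quotient.mk (maximalIdeal A ^ n)) J :=
    eq_of_le_of_not_lt (Ideal.map_mono hKJ) h1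
  have h3 := congrArg (Ideal.comap (Ideal.Quotient.mk (maximalIdeal A ^ n))) h2
  simp only [Ideal.comap_map_of_surjective _ Ideal.Quotient.mk_surjective,
      ← RingHom.ker_eq_comap_bot, Ideal.mk_ker] at h3
  rwa [sup_of_le_left (hle K hK), sup_of_le_left (hle J hJ)] at h3

/-- initial forms of degree n of T -/
def initIdeal (T : Subring A) (hT : ∀ a, ∃ s ∈ T, a - s ∈ maximalIdeal A) (n : ℕ) : Ideal A where
  carrier := {a | ∃ t ∈ T, t ∈ maximalIdeal A ^ n ∧ a - t ∈ maximalIdeal A ^ (n+1)}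
  zero_mem' := ⟨0, T.zero_mem, Ideal.zero_mem _, by simp⟩
  add_mem' := by
    rintro a b ⟨s, hs, hs', h1⟩ ⟨t, ht, ht', h2⟩
    refine ⟨s + t, T.add_mem hs ht, Ideal.add_mem _ hs' ht', ?_⟩
    have := Ideal.add_mem _ h1 h2
    rwa [← add_sub_add_comm] at this
  smul_mem' := by
    rintro b a ⟨t, ht, ht', h1⟩
    obtain ⟨s, hs, h2⟩ := hT b
    refine ⟨s * t, T.mul_mem hs ht, Ideal.mul_mem_left _ _ ht', ?_⟩
    rw [smul_eq_mul, show b * a - s * t = b * (a - t) + (b - s) * t by ring]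
    refine Ideal.add_mem _ (Ideal.mul_mem_left _ _ h1) ?_
    rw [pow_succ' (maximalIdeal A)]
    exact Ideal.mul_mem_mul h2 ht'

theorem chain_stab [IsNoetherianRing A] (c : Set (Subring A)) (_hc : IsChain (· ≤ ·) c)
    (hS : ∀ S ∈ c, IsCoef S) (n : ℕ) : ∀ S ∈ c, ∃ S' ∈ c, S' ≤ S ∧ ∀ T ∈ c, T ≤ S' →
      ∀ a ∈ S', ∃ t ∈ T, a - t ∈ maximalIdeal A ^ n := by
  induction n with
  | zero => exact fun S hS => ⟨S, hS, le_rfl, fun T _ _ a _ => ⟨0, T.zero_mem, by simp⟩⟩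
  | succ n ih =>
    intro S0 hS0
    obtain ⟨S, hSc, hS0, hst⟩ := ih S0 hS0
    let F : Set (Ideal A) := {J | ∃ (T : Subring A) (h : T ∈ c), T ≤ S ∧
      J = initIdeal T (hS T h).2 n}
    obtain ⟨J, ⟨T, hT, hTS, rfl⟩, hmin⟩ := wf_quot (n+1) F ⟨_, S, hSc, le_rfl, rfl⟩ (by
      rintro J ⟨T, hT, hTS, rfl⟩ a ha
      exact ⟨0, T.zero_mem, Ideal.zero_mem _, by simpa using ha⟩)
    refine ⟨T, hT, hTS.trans hS0, fun U hU hUT a ha => ?_⟩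
    have h1 := hmin _ ⟨U, hU, hUT.trans hTS, rfl⟩ (by
      rintro a ⟨t, ht, h⟩
      exact ⟨t, hUT ht, h⟩)
    obtain ⟨u, hu, hau⟩ := hst U hU (hUT.trans hTS) a (hTS ha)
    have h2 : a - u ∈ initIdeal T (hS T hT).2 n :=
      ⟨a - u, T.sub_mem ha (hUT hu), hau, by simp⟩
    rw [← h1] at h2
    obtain ⟨u', hu', _, h3⟩ := h2
    exact ⟨u + u', U.add_mem hu hu', by rwa [← sub_sub]⟩

theorem isCoef_sInf [IsNoetherianRing A] [IsAdicComplete (maximalIdeal A) A] (c : Set (Subring A))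
    (hc : IsChain (· ≤ ·) c) (hne : c.Nonempty) (hS : ∀ S ∈ c, IsCoef S) : IsCoef (sInf c) := by
  refine ⟨fun a ha => ?_, fun a => ?_⟩
  · rw [Subring.mem_sInf]
    intro S hSc
    refine (hS S hSc).1 a fun n => ?_
    obtain ⟨s, hs, h⟩ := ha n
    exact ⟨s, Subring.mem_sInf.1 hs S hSc, h⟩
  · choose! g hgc hgle hg using chain_stab c hc hS
    obtain ⟨S0, hS0⟩ := hne
    let s : ℕ → Subring A := fun n => Nat.rec (g 0 S0) (fun n S => g (n+1) S) n
    have hs0 : ∀ n, s n ∈ c := by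
      intro n
      induction n with
      | zero => exact hgc 0 _ hS0
      | succ n ih => exact hgc (n+1) _ ih
    have hsle : ∀ n, s (n+1) ≤ s n := fun n => hgle (n+1) _ (hs0 n)
    have hst : ∀ n, ∀ T ∈ c, T ≤ s n → ∀ a ∈ s n, ∃ t ∈ T, a - t ∈ maximalIdeal A ^ n := by
      intro n
      cases n with
      | zero => exact hg 0 _ hS0
      | succ n => exact hg (n+1) _ (hs0 n)
    obtain ⟨a0, ha0, haa0⟩ := (hS _ (hs0 1)).2 a
    have hst' : ∀ n, ∀ a, a ∈ s (n+1) → ∃ t ∈ s (n+2), a - t ∈ maximalIdeal A ^ (n+1) :=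
      fun n a ha => hst (n+1) (s (n+2)) (hs0 (n+2)) (hsle (n+1)) a ha
    choose! h hh1 hh2 using hst'
    let f : ℕ → A := fun n => Nat.rec a0 (fun n x => h n x) n
    have hf : ∀ n, f n ∈ s (n+1) := by
      intro n
      induction n with
      | zero => exact ha0
      | succ n ih => exact hh1 n _ ih
    have hf2 : ∀ n, f (n+1) - f n ∈ maximalIdeal A ^ (n+1) := by
      intro n
      rw [← neg_mem_iff, neg_sub]
      exact hh2 n _ (hf n)
    obtain ⟨l, hl⟩ := adic_compl (maximalIdeal A) f
      fun n => Ideal.pow_le_pow_right (Nat.le_succ n) (hf2 n)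
    refine ⟨l, ?_, ?_⟩
    · rw [Subring.mem_sInf]
      intro T hT
      refine (hS T hT).1 l fun n => ?_
      have hfn : f n ∈ s n := hsle n (hf n)
      rcases hc.total hT (hs0 n) with h1 | h1
      · obtain ⟨t, ht, h2⟩ := hst n T hT h1 _ hfn
        refine ⟨t, ht, ?_⟩
        have := Ideal.add_mem _ (hl n) h2
        rwa [sub_add_sub_cancel] at this
      · exact ⟨f n, h1 hfn, hl n⟩
    · have h1 := hl 1
      have h2 := hf2 0
      rw [zero_add, pow_one] at h2
      rw [pow_one] at h1
      have h3 := Ideal.sub_mem _ haa0 (Ideal.add_mem _ h1 h2)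
      have h4 : a - f 0 - (l - f 1 + (f 1 - f 0)) = a - l := by ring
      rw [← h4]; exact h3

theorem exists_min_coef [IsNoetherianRing A] [IsAdicComplete (maximalIdeal A) A] :
    ∃ D : Subring A, IsCoef D ∧ ∀ S : Subring A, IsCoef S → S ≤ D → S = D := by
  obtain ⟨D, -, hD⟩ := @zorn_le_nonempty₀ (Subring A)ᵒᵈ _ {S | IsCoef (A := A) S}
    (fun c hcS hc y hy => ⟨(sInf c : Subring A),
      isCoef_sInf (A := A) c hc.symm ⟨y, hy⟩ fun S hS => hcS hS,
      fun z hz => (sInf_le hz : (sInf c : Subring A) ≤ z)⟩)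
    (⊤ : Subring A) ⟨fun _ _ => trivial, fun a => ⟨a, trivial, by simp⟩⟩
  exact ⟨D, hD.1, fun S hS hSD => le_antisymm hSD (hD.2 hS hSD)⟩

end
end Izumi

namespace Izumi
open Polynomial

section sect
variable {O : Type*} [CommRing O] (N : Ideal O)

theorem sect_irr {K : Type*} [Field K] (f : K →+* O) (hN : N ≠ ⊤) {a : O} {P : K[X]}
    (hP : Irreducible P) (h0 : P.eval₂ f a = 0) (Q : K[X]) (hQ : Q.eval₂ f a ∈ N) :
    Q.eval₂ f a = 0 := by
  rcases EuclideanDomain.dvd_or_coprime P Q hP with h | h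
  · obtain ⟨R, rfl⟩ := h
    rw [eval₂_mul, h0, zero_mul]
  · obtain ⟨U, V, hUV⟩ := h
    have := congrArg (eval₂ f a) hUV
    rw [eval₂_add, eval₂_mul, eval₂_mul, h0, mul_zero, zero_add, eval₂_one] at this
    exact absurd ((Ideal.eq_top_iff_one _).2 (this ▸ Ideal.mul_mem_left _ _ hQ)) hN

theorem sect_char0 {K : Type*} [Field K] [CharZero K] (f : K →+* O) [hN : N.IsPrime]
    (hN2 : ∀ x ∈ N, ∀ y ∈ N, x * y = 0) (a : O) :
    ∃ b : O, a - b ∈ N ∧ ∀ Q : K[X], Q.eval₂ f b ∈ N → Q.eval₂ f b = 0 := by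
  let I : Ideal K[X] := N.comap (eval₂RingHom f a)
  have hI : I.IsPrime := Ideal.IsPrime.comap _
  obtain ⟨P, hP⟩ := (IsPrincipalIdealRing.principal I).principal
  have hmem : ∀ Q, Q.eval₂ f a ∈ N ↔ P ∣ Q := by
    intro Q
    have : Q ∈ I ↔ P ∣ Q := by rw [hP]; exact Ideal.mem_span_singleton
    exact this
  by_cases hP0 : P = 0
  · refine ⟨a, by simp, fun Q hQ => ?_⟩
    rw [hmem, hP0, zero_dvd_iff] at hQ
    rw [hQ, eval₂_zero]
  have hPp : Prime P := by
    rw [← Ideal.span_singleton_prime hP0, Ideal.span, ← hP]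
    exact hI
  obtain ⟨U, V, hUV⟩ := hPp.irreducible.separable
  have h1 := congrArg (eval₂ f a) hUV
  rw [eval₂_add, eval₂_mul, eval₂_mul, eval₂_one] at h1
  have hn : P.eval₂ f a ∈ N := (hmem P).2 dvd_rfl
  refine ⟨a + -(V.eval₂ f a * P.eval₂ f a), by simpa using Ideal.mul_mem_left _ _ hn,
    sect_irr N f hN.ne_top hPp.irreducible ?_⟩
  obtain ⟨k, hk⟩ := Polynomial.binomExpansion (P.map f) a (-(V.eval₂ f a * P.eval₂ f a))
  rw [derivative_map, eval_map, eval_map, eval_map] at hk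
  rw [hk]
  have h2 := hN2 _ hn _ hn
  linear_combination (- eval₂ f a P) * h1 + (U.eval₂ f a + k * V.eval₂ f a ^ 2) * h2

theorem sect_charp {K : Type*} [Field K] (f : K →+* O) [hN : N.IsPrime] (p : ℕ) [hp : Fact p.Prime]
    [CharP O p] (a : O) (c : K) (hc : f c = a ^ p) (ha : ∀ r, a - f r ∉ N)  (Q : K[X])
    (hQ : Q.eval₂ f a ∈ N) : Q.eval₂ f a = 0 := by
  refine sect_irr N f hN.ne_top (P := X ^ p - C c) ?_ (by simp [hc]) Q hQ
  refine X_pow_sub_C_irreducible_of_prime hp.out ?_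
  rintro b rfl
  refine ha b (hN.mem_of_pow_mem p ?_)
  rw [sub_pow_char, ← hc, map_pow, sub_self]
  exact N.zero_mem

theorem sect_zorn (F0 : Subring O) (h0 : ∀ x ∈ F0, x ∈ N → x = 0) :
    ∃ F : Subring O, F0 ≤ F ∧ (∀ x ∈ F, x ∈ N → x = 0) ∧
      ∀ G : Subring O, F ≤ G → (∀ x ∈ G, x ∈ N → x = 0) → G = F := by
  obtain ⟨F, hF0, hF⟩ := zorn_le_nonempty₀ {F : Subring O | ∀ x ∈ F, x ∈ N → x = 0} (by
    intro c hcS hc y hy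
    refine ⟨sSup c, ?_, fun z hz => le_sSup hz⟩
    intro x hx hxN
    obtain ⟨S, hS, hxS⟩ := (Subring.mem_sSup_of_directedOn ⟨y, hy⟩ hc.directedOn).1 hx
    exact hcS hS x hxS hxN) F0 h0
  exact ⟨F, hF0, hF.1, fun G hG h => le_antisymm (hF.2 h hG) hG⟩

theorem sect_isUnit [N.IsMaximal] (hN2 : ∀ x ∈ N, ∀ y ∈ N, x * y = 0) {x : O} (hx : x ∉ N) :
    ∃ y, x * y = 1 := by
  obtain ⟨y, i, hi, h⟩ := (Ideal.IsMaximal.exists_inv (I := N) inferInstance hx)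
  refine ⟨y * (1 + i), ?_⟩
  have := hN2 i hi i hi
  linear_combination (1 + i) * h - this

/-- adjoining an element to a subring -/
theorem sect_adjoin (F : Subring O)
    (hmax : ∀ G : Subring O, F ≤ G → (∀ x ∈ G, x ∈ N → x = 0) → G = F) (b : O)
    (hb : ∀ Q : F[X], Q.eval₂ F.subtype b ∈ N → Q.eval₂ F.subtype b = 0) : b ∈ F := by
  have := hmax (eval₂RingHom F.subtype b).range (by
    intro x hx
    exact ⟨C ⟨x, hx⟩, by simp⟩) (by
    rintro _ ⟨Q, rfl⟩ hQ
    exact hb Q hQ)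
  rw [← this]
  exact ⟨X, by simp⟩

theorem sect_field [hN : N.IsMaximal] (hN2 : ∀ x ∈ N, ∀ y ∈ N, x * y = 0) (F : Subring O)
    (hF : ∀ x ∈ F, x ∈ N → x = 0)
    (hmax : ∀ G : Subring O, F ≤ G → (∀ x ∈ G, x ∈ N → x = 0) → G = F) : IsField F := by
  have hN1 : (1 : O) ∉ N := (Ideal.ne_top_iff_one _).1 hN.ne_top
  refine ⟨⟨0, 1, ?_⟩, mul_comm, ?_⟩
  · intro h
    apply hN1
    have : (0 : O) = 1 := congrArg Subtype.val h
    rw [← this]; exact N.zero_mem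
  · rintro ⟨x, hx⟩ hx0
    have hxN : x ∉ N := fun h => hx0 (Subtype.ext (hF x hx h))
    obtain ⟨y, hy⟩ := sect_isUnit N hN2 hxN
    suffices hyF : y ∈ F from ⟨⟨y, hyF⟩, Subtype.ext hy⟩
    refine sect_adjoin N F hmax y fun Q hQ => ?_
    have key : ∀ Q : F[X], ∃ k : ℕ, x ^ k * Q.eval₂ F.subtype y ∈ F := by
      intro Q
      induction Q using Polynomial.induction_on with
      | C a => exact ⟨0, by simp⟩
      | add P Q hP hQ =>
        obtain ⟨k, hk⟩ := hP
        obtain ⟨l, hl⟩ := hQ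
        refine ⟨k + l, ?_⟩
        rw [eval₂_add, show x ^ (k + l) * (eval₂ F.subtype y P + eval₂ F.subtype y Q) =
          x ^ l * (x ^ k * eval₂ F.subtype y P) + x ^ k * (x ^ l * eval₂ F.subtype y Q) by ring]
        exact F.add_mem (F.mul_mem (F.pow_mem hx _) hk) (F.mul_mem (F.pow_mem hx _) hl)
      | monomial n a ih =>
        refine ⟨n+1, ?_⟩
        rw [eval₂_mul, eval₂_C, eval₂_X_pow, mul_left_comm, ← mul_pow, hy, one_pow, mul_one]
        exact a.2
    obtain ⟨k, hk⟩ := key Q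
    have h1 := hF _ hk (Ideal.mul_mem_left _ _ hQ)
    have h2 : y ^ k * x ^ k = 1 := by rw [← mul_pow, mul_comm, hy, one_pow]
    rw [← one_mul (eval₂ _ _ _), ← h2, mul_assoc, h1, mul_zero]

theorem exists_sect [hN : N.IsMaximal] (hN2 : ∀ x ∈ N, ∀ y ∈ N, x * y = 0) (p : ℕ)
    (hp : (p.Prime ∧ (p : O) = 0) ∨ (∀ n : ℕ, n ≠ 0 → (n : O) ∉ N)) :
    ∃ F : Subring O, (∀ x ∈ F, x ∈ N → x = 0) ∧ ∀ a, ∃ r ∈ F, a - r ∈ N := by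
  have hN1 : (1 : O) ∉ N := (Ideal.ne_top_iff_one _).1 hN.ne_top
  rcases hp with ⟨hp, hp0⟩ | hp
  · have : Fact p.Prime := ⟨hp⟩
    have : Nontrivial O := ⟨0, 1, fun h => hN1 (h ▸ N.zero_mem)⟩
    have : CharP O p := by
      exact (CharP.charP_iff_prime_eq_zero hp).2 hp0
    obtain ⟨F, hF0, hF, hmax⟩ := sect_zorn N (frobenius O p).range (by
      rintro _ ⟨x, rfl⟩ hx
      rw [frobenius_def] at hx ⊢
      have hxN := hN.isPrime.mem_of_pow_mem p hx
      obtain ⟨k, hk⟩ := Nat.exists_eq_add_of_le hp.two_le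
      rw [hk, pow_add, pow_two, hN2 x hxN x hxN, zero_mul])
    let _ : Field F := (sect_field N hN2 F hF hmax).toField
    refine ⟨F, hF, ?_⟩
    by_contra! hcon
    obtain ⟨a, ha⟩ := hcon
    have haF : a ∈ F := sect_adjoin N F hmax a
      (sect_charp N F.subtype p a ⟨a ^ p, hF0 ⟨a, rfl⟩⟩ rfl (fun r => ha r r.2))
    exact ha a haF (by simp)
  · obtain ⟨F, hF0, hF, hmax⟩ := sect_zorn N (Int.castRingHom O).range (by
      rintro _ ⟨x, rfl⟩ hx
      by_contra hne
      have h1 : x.natAbs ≠ 0 := by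
        intro h
        rw [Int.natAbs_eq_zero] at h
        rw [h] at hne; simp at hne
      refine hp _ h1 ?_
      rcases Int.natAbs_eq x with h | h
      · rw [h] at hx; simpa using hx
      · rw [h] at hx; simpa using hx)
    let _ : Field F := (sect_field N hN2 F hF hmax).toField
    have : CharZero F := by
      refine charZero_of_inj_zero fun n hn => ?_
      by_contra hne
      refine hp n hne ?_
      have := congrArg F.subtype hn
      rw [map_natCast, map_zero] at this
      rw [this]; exact N.zero_mem
    refine ⟨F, hF, fun a => ?_⟩
    obtain ⟨b, hb, hb'⟩ := sect_char0 N F.subtype hN2 a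
    exact ⟨b, sect_adjoin N F hmax b hb', hb⟩

end sect
end Izumi

namespace Izumi

section
variable {A : Type*} [CommRing A] [IsLocalRing A]

/-- the trace of the maximal ideal -/
abbrev mD (D : Subring A) : Ideal D := (maximalIdeal A).comap D.subtype

/-- the closure of an ideal of a subring -/
def clos (D : Subring A) (J : Ideal D) : Ideal D where
  carrier := {d | ∀ n, ∃ j ∈ J, ((d - j : D) : A) ∈ maximalIdeal A ^ n}
  zero_mem' := fun n => ⟨0, J.zero_mem, by simp⟩
  add_mem' := by
    intro a b ha hb n
    obtain ⟨i, hi, h1⟩ := ha n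
    obtain ⟨j, hj, h2⟩ := hb n
    refine ⟨i + j, J.add_mem hi hj, ?_⟩
    rw [add_sub_add_comm]
    exact Ideal.add_mem _ h1 h2
  smul_mem' := by
    intro c a ha n
    obtain ⟨i, hi, h1⟩ := ha n
    refine ⟨c * i, J.mul_mem_left _ hi, ?_⟩
    rw [smul_eq_mul, ← mul_sub]
    exact Ideal.mul_mem_left _ _ h1

theorem mem_clos {D : Subring A} {J : Ideal D} {d : D} :
    d ∈ clos D J ↔ ∀ n, ∃ j ∈ J, ((d - j : D) : A) ∈ maximalIdeal A ^ n := Iff.rfl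

theorem le_clos (D : Subring A) (J : Ideal D) : J ≤ clos D J :=
  fun j hj n => ⟨j, hj, by simp⟩

theorem mem_clos_of {D : Subring A} {J : Ideal D} {d : D}
    (h : ∀ n, ∃ j ∈ clos D J, ((d - j : D) : A) ∈ maximalIdeal A ^ n) : d ∈ clos D J := by
  intro n
  obtain ⟨j, hj, h1⟩ := h n
  obtain ⟨i, hi, h2⟩ := hj n
  refine ⟨i, hi, ?_⟩
  have := Ideal.add_mem _ h1 h2
  rwa [← D.coe_add, sub_add_sub_cancel] at this

theorem mD_max {D : Subring A} (hD : IsCoef D) : (mD D).IsMaximal := by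
  have hsurj : Function.Surjective ((residue A).comp D.subtype) := by
    intro x
    obtain ⟨a, rfl⟩ := residue_surjective x
    obtain ⟨s, hs, h⟩ := hD.2 a
    refine ⟨⟨s, hs⟩, ?_⟩
    rw [← residue_eq_zero_iff, map_sub, sub_eq_zero] at h
    exact h.symm
  have h1 : mD D = RingHom.ker ((residue A).comp D.subtype) := by
    ext x
    rw [RingHom.mem_ker, RingHom.comp_apply, residue_eq_zero_iff]; rfl
  rw [h1]
  exact RingHom.ker_isMaximal_of_surjective _ hsurj

theorem mD_le_clos {D : Subring A} (hD : IsCoef D)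
    (hmin : ∀ S : Subring A, IsCoef S → S ≤ D → S = D) (p : ℕ)
    (hp : (p.Prime ∧ (p : A) ∈ maximalIdeal A) ∨ (∀ n : ℕ, n ≠ 0 → (n : A) ∉ maximalIdeal A) ∧ p = 0) :
    mD D ≤ clos D (Ideal.span {(p : D)} ⊔ mD D * mD D) := by
  set J := Ideal.span {(p : D)} ⊔ mD D * mD D with hJ
  have hmax := mD_max hD
  have hpm : (p : D) ∈ mD D := by
    rw [Ideal.mem_comap, map_natCast]
    rcases hp with hp | hp
    · exact hp.2
    · rw [hp.2, Nat.cast_zero]; exact Ideal.zero_mem _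
  have hJm : J ≤ mD D := by
    refine sup_le ?_ Ideal.mul_le_left
    rw [Ideal.span_le, Set.singleton_subset_iff]
    exact hpm
  have hIm : clos D J ≤ mD D := by
    intro d hd
    obtain ⟨j, hj, h⟩ := hd 1
    rw [pow_one] at h
    have : d - j ∈ mD D := h
    have := Ideal.add_mem _ this (hJm hj)
    rwa [sub_add_cancel] at this
  let π := Ideal.Quotient.mk (clos D J)
  have hπ : Function.Surjective π := Ideal.Quotient.mk_surjective
  let N : Ideal (D ⧸ clos D J) := (mD D).map π
  have hN : ∀ d, π d ∈ N ↔ d ∈ mD D := by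
    intro d
    have : (mD D).map π = N := rfl
    rw [← this, ← Ideal.mem_comap, Ideal.comap_map_of_surjective _ hπ, ← RingHom.ker_eq_comap_bot,
      Ideal.mk_ker, sup_of_le_left hIm]
  have hNmax : N.IsMaximal := by
    refine Ideal.IsMaximal.map_of_surjective_of_ker_le hπ ?_
    rw [Ideal.mk_ker]; exact hIm
  obtain ⟨F, hF, hF2⟩ := exists_sect N (by
    intro x hx y hy
    obtain ⟨x, rfl⟩ := hπ x
    obtain ⟨y, rfl⟩ := hπ y
    rw [hN] at hx hy
    rw [← map_mul]
    refine Ideal.Quotient.eq_zero_iff_mem.2 (le_clos D J ?_)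
    exact Ideal.mem_sup_right (Ideal.mul_mem_mul hx hy)) p (by
    rcases hp with hp | hp
    · left
      refine ⟨hp.1, ?_⟩
      rw [← map_natCast π]
      refine Ideal.Quotient.eq_zero_iff_mem.2 (le_clos D J ?_)
      exact Ideal.mem_sup_left (Ideal.mem_span_singleton_self _)
    · right
      intro n hn h
      rw [← map_natCast π, hN] at h
      rw [Ideal.mem_comap, map_natCast] at h
      exact hp.1 n hn h)
  let E : Subring A := (F.comap π).map D.subtype
  have hE : ∀ d : D, (d : A) ∈ E ↔ π d ∈ F := by
    intro d
    constructor
    · rintro ⟨d', hd', h⟩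
      have : d' = d := Subtype.ext h
      rw [← this]; exact hd'
    · intro h
      exact ⟨d, h, rfl⟩
  have hED : E ≤ D := by
    rintro _ ⟨d', hd', rfl⟩
    exact d'.2
  have key : IsCoef E := by
    refine ⟨fun a ha => ?_, fun a => ?_⟩
    · have haD : a ∈ D := hD.1 a fun n => by
        obtain ⟨s, hs, h⟩ := ha n
        exact ⟨s, hED hs, h⟩
      obtain ⟨d, rfl⟩ : ∃ d : D, (d : A) = a := ⟨⟨a, haD⟩, rfl⟩
      rw [hE]
      obtain ⟨r, hr, hdr⟩ := hF2 (π d)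
      obtain ⟨r, rfl⟩ := hπ r
      suffices h : d - r ∈ clos D J by
        have h2 : π d = π r := Ideal.Quotient.mk_eq_mk_iff_sub_mem _ _ |>.2 h
        rw [h2]; exact hr
      rw [← map_sub, hN] at hdr
      refine mem_clos_of fun n => ?_
      obtain ⟨s, hs, h⟩ := ha (n+1)
      obtain ⟨s, rfl⟩ : ∃ d : D, (d : A) = s := ⟨⟨s, hED hs⟩, rfl⟩
      rw [hE] at hs
      refine ⟨s - r, ?_, ?_⟩
      · refine Ideal.Quotient.eq_zero_iff_mem.1 (hF _ ?_ ?_)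
        · have := F.sub_mem hs hr
          rwa [← map_sub] at this
        · have h3 : d - s ∈ mD D := by
            have := Ideal.pow_le_self (Nat.succ_ne_zero n) h
            exact this
          rw [show (Ideal.Quotient.mk (clos D J)) = π from rfl, hN]
          have := Ideal.sub_mem _ hdr h3
          rwa [sub_sub_sub_cancel_left] at this
      · rw [sub_sub_sub_cancel_right]
        exact Ideal.pow_le_pow_right (Nat.le_succ n) h
    · obtain ⟨d, hd, h⟩ := hD.2 a
      obtain ⟨r, hr, hdr⟩ := hF2 (π ⟨d, hd⟩)
      obtain ⟨r, rfl⟩ := hπ r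
      rw [← map_sub, hN] at hdr
      refine ⟨r, (hE r).2 hr, ?_⟩
      have h2 : d - (r : A) ∈ maximalIdeal A := hdr
      have := Ideal.add_mem _ h h2
      rwa [sub_add_sub_cancel] at this
  have hEeq := hmin E key hED
  intro x hx
  refine Ideal.Quotient.eq_zero_iff_mem.1 (hF _ ?_ ((hN x).2 hx))
  refine (hE x).1 ?_
  rw [hEeq]; exact x.2

theorem mD_approx {D : Subring A} (hD : IsCoef D)
    (hmin : ∀ S : Subring A, IsCoef S → S ≤ D → S = D) (p : ℕ)
    (hp : (p.Prime ∧ (p : A) ∈ maximalIdeal A) ∨ (∀ n : ℕ, n ≠ 0 → (n : A) ∉ maximalIdeal A) ∧ p = 0)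
    (n : ℕ) : ∀ x ∈ mD D, ∃ d : D, (x : A) - p * d ∈ maximalIdeal A ^ (n+1) := by
  have h0 := mD_le_clos hD hmin p hp
  induction n with
  | zero => exact fun x hx => ⟨0, by simpa using hx⟩
  | succ n ih =>
    intro x hx
    have h1 : ∀ y ∈ mD D * mD D, ∃ d : D, (y : A) - p * d ∈ maximalIdeal A ^ (n+1+1) := by
      intro y hy
      induction hy using Submodule.mul_induction_on' with
      | mem_mul_mem u hu v hv =>
        obtain ⟨d, hd⟩ := ih u hu
        refine ⟨d * v, ?_⟩
        have h2 := Ideal.mul_mem_mul hd (show (v : A) ∈ maximalIdeal A from hv)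
        rw [← pow_succ] at h2
        convert h2 using 1
        push_cast; ring
      | add u _ v _ hu hv =>
        obtain ⟨d, hd⟩ := hu
        obtain ⟨e, he⟩ := hv
        refine ⟨d + e, ?_⟩
        convert Ideal.add_mem _ hd he using 1
        push_cast; ring
    obtain ⟨j, hj, hxj⟩ := h0 hx (n+1+1)
    obtain ⟨a, ha, y, hy, rfl⟩ := Submodule.mem_sup.1 hj
    obtain ⟨c, rfl⟩ := Ideal.mem_span_singleton'.1 ha
    obtain ⟨d, hd⟩ := h1 y hy
    refine ⟨c + d, ?_⟩
    convert Ideal.add_mem _ hxj hd using 1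
    push_cast; ring

theorem coef_isLocalHom {D : Subring A} (hD : IsCoef D) : IsLocalHom D.subtype := by
  refine ⟨fun d hd => ?_⟩
  have hd' : IsUnit (d : A) := hd
  obtain ⟨u, hu⟩ := hd'.exists_right_inv
  obtain ⟨e, he, hue⟩ := hD.2 u
  -- d * e = 1 - m
  have hm : 1 - (d : A) * e ∈ maximalIdeal A := by
    rw [← hu, ← mul_sub]; exact Ideal.mul_mem_left _ _ hue
  have hmD : 1 - (d : A) * e ∈ D := D.sub_mem D.one_mem (D.mul_mem d.2 he)
  suffices h : u ∈ D from isUnit_iff_exists_inv.2 ⟨⟨u, h⟩, Subtype.ext hu⟩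
  refine hD.1 u fun n => ⟨e * ∑ i ∈ Finset.range n, (1 - (d : A) * e) ^ i,
    D.mul_mem he (D.sum_mem fun i _ => D.pow_mem hmD i), ?_⟩
  have h1 := mul_neg_geom_sum (1 - (d : A) * e) n
  rw [sub_sub_cancel] at h1
  have h2 : u - e * ∑ i ∈ Finset.range n, (1 - (d : A) * e) ^ i = u * (1 - (d : A) * e) ^ n := by
    linear_combination (-u) * h1 + (e * ∑ i ∈ Finset.range n, (1 - (d : A) * e) ^ i) * hu
  rw [h2]
  exact Ideal.mul_mem_left _ _ (Ideal.pow_mem_pow hm n)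

end
end Izumi

namespace Izumi

section
variable {A : Type u} [CommRing A] [IsLocalRing A] [IsNoetherianRing A]

theorem ideal_closed (K : Ideal A) (x : A)
    (hx : ∀ n, ∃ k ∈ K, x - k ∈ maximalIdeal A ^ n) : x ∈ K := by
  have h1 : Ideal.Quotient.mk K x ∈ (⨅ i, maximalIdeal A ^ i • ⊤ : Submodule A (A ⧸ K)) := by
    rw [Submodule.mem_iInf]
    intro n
    obtain ⟨k, hk, h⟩ := hx n
    have h2 : Ideal.Quotient.mk K x = (x - k) • (1 : A ⧸ K) := by
      rw [Algebra.smul_def, mul_one]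
      refine (Ideal.Quotient.mk_eq_mk_iff_sub_mem _ _).2 ?_
      rwa [sub_sub_cancel]
    rw [h2]
    exact Submodule.smul_mem_smul h trivial
  rw [Ideal.iInf_pow_smul_eq_bot_of_isLocalRing _ Ideal.IsPrime.ne_top', Submodule.mem_bot] at h1
  exact Ideal.Quotient.eq_zero_iff_mem.1 h1

variable [IsDomain A]

theorem artin_rees_dvd {q : A} (hq0 : q ≠ 0) (m : ℕ) :
    ∃ n, ∀ a, q * a ∈ maximalIdeal A ^ n → a ∈ maximalIdeal A ^ m := by
  obtain ⟨k, hk⟩ := Ideal.exists_pow_inf_eq_pow_smul (maximalIdeal A) (Ideal.span {q})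
  refine ⟨m + k, fun a ha => ?_⟩
  have h1 := hk (m + k) (Nat.le_add_left _ _)
  have h2 : q * a ∈ maximalIdeal A ^ (m + k) • (⊤ : Submodule A A) ⊓ Ideal.span {q} := by
    refine ⟨?_, Ideal.mul_mem_right _ _ (Ideal.mem_span_singleton_self _)⟩
    rw [smul_eq_mul, Ideal.mul_top]; exact ha
  rw [h1, Nat.add_sub_cancel] at h2
  have h3 : maximalIdeal A ^ m • (maximalIdeal A ^ k • (⊤ : Submodule A A) ⊓ Ideal.span {q}) ≤
      Ideal.span {q} * maximalIdeal A ^ m := by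
    rw [smul_eq_mul, mul_comm (Ideal.span {q})]
    exact Ideal.mul_mono_right inf_le_right
  obtain ⟨b, hb, h4⟩ := Ideal.mem_span_singleton_mul.1 (h3 h2)
  rwa [← mul_left_cancel₀ hq0 h4]

theorem cohen [IsAdicComplete (maximalIdeal A) A] :
    (∃ p, HasGood A p ⊥ 0) ∨
      ∃ q ∈ maximalIdeal A, q ≠ 0 ∧ HasGood A 1 (Ideal.span {q}) 1 := by
  obtain ⟨D, hD, hmin⟩ := exists_min_coef (A := A)
  obtain ⟨p, hp⟩ : ∃ p : ℕ, (p.Prime ∧ (p : A) ∈ maximalIdeal A) ∨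
      (∀ n : ℕ, n ≠ 0 → (n : A) ∉ maximalIdeal A) ∧ p = 0 := by
    have hk : ∀ n : ℕ, (n : A) ∈ maximalIdeal A ↔ (n : ResidueField A) = 0 := by
      intro n
      rw [← residue_eq_zero_iff, map_natCast]
    rcases CharP.exists' (ResidueField A) with h | ⟨p, hp, hc⟩
    · refine ⟨0, Or.inr ⟨fun n hn => ?_, rfl⟩⟩
      rw [hk]
      exact_mod_cast hn
    · exact ⟨p, Or.inl ⟨hp.out, by rw [hk]; simp⟩⟩
  have happ := mD_approx hD hmin p hp
  have hlh := coef_isLocalHom hD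
  have hloc : IsLocalRing D := RingHom.domain_isLocalRing D.subtype
  have hmax : maximalIdeal D = mD D := (eq_maximalIdeal (mD_max hD)).symm
  have hsurj : ∀ a, ∃ r : D, a - D.subtype r ∈ maximalIdeal A := by
    intro a
    obtain ⟨s, hs, h⟩ := hD.2 a
    exact ⟨⟨s, hs⟩, h⟩
  by_cases hpA : (p : A) = 0
  · left
    have hbot : maximalIdeal D = ⊥ := by
      rw [hmax, eq_bot_iff]
      intro x hx
      have h1 : (x : A) ∈ ⨅ n, maximalIdeal A ^ n := by
        rw [Ideal.mem_iInf]
        intro n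
        obtain ⟨d, hd⟩ := happ n x hx
        rw [hpA, zero_mul, sub_zero] at hd
        exact Ideal.pow_le_pow_right (Nat.le_succ n) hd
      rw [Ideal.iInf_pow_eq_bot_of_isLocalRing _ Ideal.IsPrime.ne_top'] at h1
      exact Subtype.ext h1
    have hfield : IsField D := isField_iff_maximalIdeal_eq.2 hbot
    let _ : Field D := hfield.toField
    obtain ⟨q, hq⟩ := ExpChar.exists D
    refine ⟨q, D, inferInstance, hloc, PEmpty.{1}, inferInstance, fun x => x.elim, D.subtype,
      inferInstance, field_qring D, by simp, hq, field_cart D q, ?_, hsurj⟩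
    rw [hbot, Ideal.map_bot]
  · right
    have hpm : p.Prime ∧ (p : A) ∈ maximalIdeal A := by
      rcases hp with hp | hp
      · exact hp
      · rw [hp.2, Nat.cast_zero] at hpA
        exact absurd rfl hpA
    have hdiv : ∀ a : A, (p : A) * a ∈ D → a ∈ D := by
      intro a ha
      refine hD.1 a fun m => ?_
      obtain ⟨n, hn⟩ := artin_rees_dvd hpA m
      obtain ⟨d, hd⟩ := happ n ⟨_, ha⟩ (Ideal.mul_mem_right _ _ hpm.2)
      refine ⟨d, d.2, hn _ ?_⟩
      rw [mul_sub]
      exact Ideal.pow_le_pow_right (Nat.le_succ n) hd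
    have hpow : ∀ n (a : A), (p : A) ^ n * a ∈ D → a ∈ D := by
      intro n
      induction n with
      | zero => intro a ha; simpa using ha
      | succ n ih =>
        intro a ha
        rw [pow_succ, mul_assoc] at ha
        exact hdiv _ (ih _ ha)
    have hspan : maximalIdeal D = Ideal.span {(p : D)} := by
      rw [hmax]
      apply le_antisymm
      · intro x hx
        have h1 : (x : A) ∈ Ideal.span {(p : A)} := by
          refine ideal_closed _ _ fun n => ?_
          obtain ⟨d, hd⟩ := happ n x hx
          exact ⟨p * d, Ideal.mul_mem_right _ _ (Ideal.mem_span_singleton_self _),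
            Ideal.pow_le_pow_right (Nat.le_succ n) hd⟩
        obtain ⟨a, ha⟩ := Ideal.mem_span_singleton.1 h1
        have h2 : a ∈ D := hdiv a (ha ▸ x.2)
        exact Ideal.mem_span_singleton.2 ⟨⟨a, h2⟩, Subtype.ext (by rw [ha]; simp)⟩
      · rw [Ideal.span_le, Set.singleton_subset_iff]
        change D.subtype _ ∈ maximalIdeal A
        rw [map_natCast]; exact hpm.2
    have hp0 : (p : D) ≠ 0 := by
      intro h
      apply hpA
      have := congrArg D.subtype h
      rwa [map_natCast, map_zero] at this
    have hmem : ∀ n (x : D), x ∈ maximalIdeal D ^ n ↔ (p : A) ^ n ∣ x := by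
      intro n x
      rw [hspan, Ideal.span_singleton_pow, Ideal.mem_span_singleton]
      constructor
      · rintro ⟨c, rfl⟩
        exact ⟨c, by simp⟩
      · rintro ⟨c, hc⟩
        have h2 : c ∈ D := hpow n c (hc ▸ x.2)
        exact ⟨⟨c, h2⟩, Subtype.ext (by rw [hc]; simp)⟩
    have hmem' : ∀ n (x : D), x ∈ maximalIdeal D ^ n → (x : A) ∈ maximalIdeal A ^ n := by
      intro n x hx
      obtain ⟨c, hc⟩ := (hmem n x).1 hx
      rw [hc]
      exact Ideal.mul_mem_right _ _ (Ideal.pow_mem_pow hpm.2 n)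
    have hhaus : ∀ x : D, (∀ n, x ∈ maximalIdeal D ^ n) → x = 0 := by
      intro x hx
      refine Subtype.ext (adic_haus (maximalIdeal A) _ fun n => hmem' n x (hx n))
    have hcompl : ∀ f : ℕ → D, (∀ n, f (n+1) - f n ∈ maximalIdeal D ^ n) →
        ∃ l, ∀ n, l - f n ∈ maximalIdeal D ^ n := by
      intro f hf
      obtain ⟨l, hl⟩ := adic_compl (maximalIdeal A) (fun n => (f n : A))
        (fun n => hmem' n _ (hf n))
      have hlD : l ∈ D := hD.1 l fun n => ⟨f n, (f n).2, hl n⟩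
      have hf2 : ∀ n k, f (n + k) - f n ∈ maximalIdeal D ^ n := by
        intro n k
        induction k with
        | zero => simp
        | succ k ih =>
          have := Ideal.add_mem _ (Ideal.pow_le_pow_right (Nat.le_add_right n k) (hf (n + k))) ih
          rwa [sub_add_sub_cancel] at this
      refine ⟨⟨l, hlD⟩, fun n => ?_⟩
      rw [hmem, ← Ideal.mem_span_singleton]
      refine ideal_closed _ _ fun m => ⟨(f (n + m) - f n : D), ?_, ?_⟩
      · rw [Ideal.mem_span_singleton, ← hmem]
        exact hf2 n m
      · have := Ideal.pow_le_pow_right (Nat.le_add_left m n) (hl (n + m))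
        convert this using 1
        push_cast; ring
    have hirr : Irreducible (p : D) := by
      refine ((Ideal.span_singleton_prime hp0).1 ?_).irreducible
      rw [← hspan]; infer_instance
    have hdvr : IsDiscreteValuationRing D := by
      refine IsDiscreteValuationRing.ofHasUnitMulPowIrreducibleFactorization
        ⟨(p : D), hirr, fun {x} hx => ?_⟩
      classical
      have hex : ∃ n, x ∉ maximalIdeal D ^ n := by
        by_contra! h
        exact hx (hhaus x h)
      obtain ⟨n, hn, hn'⟩ : ∃ n, x ∈ maximalIdeal D ^ n ∧ x ∉ maximalIdeal D ^ (n+1) := by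
        refine ⟨Nat.find hex - 1, ?_, ?_⟩
        · have h0 : Nat.find hex ≠ 0 := by
            intro h
            have := Nat.find_spec hex
            rw [h] at this; simp at this
          have := Nat.find_min hex (m := Nat.find hex - 1) (by omega)
          simpa using this
        · have h0 : Nat.find hex ≠ 0 := by
            intro h
            have := Nat.find_spec hex
            rw [h] at this; simp at this
          rw [Nat.sub_add_cancel (Nat.one_le_iff_ne_zero.2 h0)]
          exact Nat.find_spec hex
      refine ⟨n, ?_⟩
      rw [hspan, Ideal.span_singleton_pow, Ideal.mem_span_singleton] at hn
      obtain ⟨c, rfl⟩ := hn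
      have hc : IsUnit c := by
        by_contra hc
        refine hn' ?_
        rw [pow_succ (maximalIdeal D)]
        refine Ideal.mul_mem_mul (Ideal.pow_mem_pow ?_ n) hc
        rw [hspan]; exact Ideal.mem_span_singleton_self _
      exact ⟨hc.unit, rfl⟩
    have hc0 : CharZero D := by
      have hA : CharZero A := by
        rcases CharP.exists' A with h | ⟨q, hq, hc⟩
        · exact h
        · exfalso
          have hpq : p ≠ q := by
            rintro rfl
            exact hpA (CharP.cast_eq_zero A p)
          obtain ⟨u, v, huv⟩ := (Nat.isCoprime_iff_coprime.2
            ((Nat.coprime_primes hpm.1 hq.out).2 hpq)).map (Int.castRingHom A)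
          simp only [map_natCast, CharP.cast_eq_zero A q, mul_zero, add_zero] at huv
          exact (Ideal.ne_top_iff_one _).1 Ideal.IsPrime.ne_top'
            (huv ▸ Ideal.mul_mem_left (maximalIdeal A) u hpm.2)
      refine charZero_of_inj_zero fun n hn => ?_
      have := congrArg D.subtype hn
      rw [map_natCast, map_zero] at this
      exact_mod_cast this
    refine ⟨(p : A), hpm.2, hpA, D, inferInstance, hloc, Unit, inferInstance, fun _ => (p : D),
      D.subtype, inferInstance, dvr_qring (p : D) hp0 hspan hcompl hhaus, by simp, inferInstance,
      fun e => by rw [one_pow]; exact cart_one D, ?_, hsurj⟩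
    rw [hspan, Ideal.map_span, Set.image_singleton, map_natCast]

end
end Izumi

namespace Izumi
open PowerSeries

section psc
variable {R : Type*} [CommRing R]

/-- sequential precompleteness -/
def SeqC (J : Ideal R) : Prop :=
  ∀ f : ℕ → R, (∀ n, f (n+1) - f n ∈ J ^ n) → ∃ l, ∀ n, l - f n ∈ J ^ n

theorem psJ_coeff (J : Ideal R) (n : ℕ) (s : R⟦X⟧)
    (hs : s ∈ (J.map (C : R →+* R⟦X⟧) ⊔ Ideal.span {X}) ^ n) (d : ℕ) :
    coeff d s ∈ J ^ (n - d) := by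
  induction n generalizing s d with
  | zero => simp
  | succ n ih =>
    rw [pow_succ] at hs
    refine Submodule.mul_induction_on hs ?_ ?_
    · intro a ha b hb
      obtain ⟨u, hu, v, hv, rfl⟩ := Submodule.mem_sup.1 hb
      rw [mul_add, map_add]
      refine Ideal.add_mem _ ?_ ?_
      · have : ∀ k, coeff k u ∈ J := by
          intro k
          refine Submodule.span_induction ?_ ?_ ?_ ?_ hu
          · rintro _ ⟨r, hr, rfl⟩
            rw [coeff_C]
            split_ifs
            · exact hr
            · exact J.zero_mem
          · simp
          · intro x y _ _ hx hy
            rw [map_add]; exact J.add_mem hx hy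
          · intro a x hxm hx
            clear hx
            have : ∀ k, coeff k x ∈ J := by
              intro k
              have hle : J.map (C : R →+* R⟦X⟧) ≤
                  RingHom.ker (PowerSeries.map (Ideal.Quotient.mk J)) := by
                rw [Ideal.map_le_iff_le_comap]
                intro r hr
                rw [Ideal.mem_comap, RingHom.mem_ker, map_C, Ideal.Quotient.eq_zero_iff_mem.2 hr,
                  map_zero]
              have h := hle hxm
              rw [RingHom.mem_ker] at h
              have h2 := congrArg (coeff k) h
              rw [coeff_map, map_zero] at h2
              exact Ideal.Quotient.eq_zero_iff_mem.1 h2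
            rw [smul_eq_mul, coeff_mul]
            exact J.sum_mem fun p _ => J.mul_mem_left _ (this _)
        rw [coeff_mul]
        refine Ideal.sum_mem _ fun p hp => ?_
        have hp' := Finset.HasAntidiagonal.mem_antidiagonal.1 hp
        have h1 := Ideal.mul_mem_mul (ih a ha p.1) (this p.2)
        rw [← pow_succ] at h1
        exact Ideal.pow_le_pow_right (by omega) h1
      · obtain ⟨w, rfl⟩ := Ideal.mem_span_singleton.1 hv
        rw [← mul_assoc, mul_comm a X, mul_assoc]
        cases d with
        | zero => simp
        | succ d =>
          rw [coeff_succ_X_mul, coeff_mul]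
          refine Ideal.sum_mem _ fun p hp => ?_
          have hp' := Finset.HasAntidiagonal.mem_antidiagonal.1 hp
          exact Ideal.mul_mem_right _ _ (Ideal.pow_le_pow_right (by omega) (ih a ha p.1))
    · intro x y hx hy
      rw [map_add]
      exact Ideal.add_mem _ hx hy

theorem psJ_mem (J : Ideal R) (n : ℕ) (s : R⟦X⟧) (hs : ∀ d, coeff d s ∈ J ^ (n - d)) :
    s ∈ (J.map (C : R →+* R⟦X⟧) ⊔ Ideal.span {X}) ^ n := by
  have hX : (X : R⟦X⟧) ∈ J.map (C : R →+* R⟦X⟧) ⊔ Ideal.span {X} :=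
    Ideal.mem_sup_right (Ideal.mem_span_singleton_self _)
  obtain ⟨u, hu⟩ := (X_pow_dvd_iff (n := n) (φ := s - (trunc n s : R⟦X⟧))).2 (by
    intro d hd
    rw [map_sub, Polynomial.coeff_coe, coeff_trunc, if_pos hd, sub_self])
  rw [← sub_add_cancel s (trunc n s : R⟦X⟧), hu]
  refine Ideal.add_mem _ (Ideal.mul_mem_right _ _ (Ideal.pow_mem_pow hX n)) ?_
  rw [Polynomial.as_sum_range_C_mul_X_pow (trunc n s)]
  rw [← Polynomial.coeToPowerSeries.ringHom_apply, map_sum]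
  refine Ideal.sum_mem _ fun d _ => ?_
  rw [Polynomial.coeToPowerSeries.ringHom_apply, Polynomial.coe_mul, Polynomial.coe_C,
    Polynomial.coe_pow, Polynomial.coe_X, coeff_trunc]
  split_ifs with h
  · have h1 : (C (coeff d s) : R⟦X⟧) ∈ (J.map (C : R →+* R⟦X⟧) ⊔ Ideal.span {X}) ^ (n - d) := by
      refine Ideal.pow_right_mono le_sup_left _ ?_
      rw [← Ideal.map_pow]
      exact Ideal.mem_map_of_mem _ (hs d)
    have h2 := Ideal.mul_mem_mul h1 (Ideal.pow_mem_pow hX d)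
    rwa [← pow_add, Nat.sub_add_cancel h.le] at h2
  · simp

theorem psJ_compl {J : Ideal R} (hJ : SeqC J) :
    SeqC (J.map (C : R →+* R⟦X⟧) ⊔ Ideal.span {X}) := by
  intro f hf
  have h1 : ∀ d, ∃ l, ∀ n, l - coeff d (f (n + d)) ∈ J ^ n := by
    intro d
    refine hJ (fun n => coeff d (f (n + d))) fun n => ?_
    have := psJ_coeff J _ _ (hf (n + d)) d
    rw [map_sub, Nat.add_sub_cancel] at this
    rw [show n + 1 + d = n + d + 1 by omega]
    exact this
  choose l hl using h1
  refine ⟨PowerSeries.mk l, fun n => psJ_mem J n _ fun d => ?_⟩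
  rw [map_sub, coeff_mk]
  rcases le_or_gt d n with h | h
  · have := hl d (n - d)
    rwa [Nat.sub_add_cancel h] at this
  · rw [Nat.sub_eq_zero_of_le h.le]; simp

end psc

/-- a Noetherian precomplete source over a complete local ring -/
def HasSrc (B : Type u) [CommRing B] [IsLocalRing B] (I : Ideal B) : Prop :=
  ∃ (R : Type u) (_ : CommRing R) (J : Ideal R) (f : R →+* B), IsNoetherianRing R ∧ SeqC J ∧
    J.map f = I ∧ (∀ a, ∃ r, a - f r ∈ maximalIdeal B)

theorem HasSrc.step {B : Type u} [CommRing B] [IsLocalRing B] [IsAdicComplete (maximalIdeal B) B]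
    {I : Ideal B} (h : HasSrc B I) {x : B} (hx : x ∈ maximalIdeal B) :
    HasSrc B (I ⊔ Ideal.span {x}) := by
  obtain ⟨R, _, J, f, hN, hQ, hI, hs⟩ := h
  obtain ⟨F, hF, hFX⟩ := ps_eval (maximalIdeal B) f hx
  refine ⟨R⟦X⟧, inferInstance, J.map (C : R →+* R⟦X⟧) ⊔ Ideal.span {X}, F, inferInstance,
    psJ_compl hQ, ?_, ?_⟩
  · rw [Ideal.map_sup, Ideal.map_map, Ideal.map_span, Set.image_singleton, hFX, ← hI]
    congr 2
    ext r
    exact hF r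
  · intro a
    obtain ⟨r, hr⟩ := hs a
    exact ⟨C r, by rwa [hF]⟩

theorem HasSrc.list {B : Type u} [CommRing B] [IsLocalRing B] [IsAdicComplete (maximalIdeal B) B]
    {I : Ideal B} (h : HasSrc B I) (s : Finset B) (hs : ∀ x ∈ s, x ∈ maximalIdeal B) :
    HasSrc B (I ⊔ Ideal.span (s : Set B)) := by
  classical
  induction s using Finset.induction_on with
  | empty => simpa using h
  | insert a s ha ih =>
    have := (ih fun x hx => hs x (Finset.mem_insert_of_mem hx)).step
      (hs a (Finset.mem_insert_self _ _))
    rw [Finset.coe_insert, Ideal.span_insert, sup_comm (Ideal.span {a}), ← sup_assoc]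
    exact this

theorem noeth_of_src {B : Type u} [CommRing B] [IsLocalRing B]
    [hB : IsAdicComplete (maximalIdeal B) B] (h : HasSrc B (maximalIdeal B)) :
    IsNoetherianRing B := by
  obtain ⟨R, _, J, f, hN, hQ, hI, hs⟩ := h
  have hpre : IsPrecomplete J R := by
    refine ⟨fun g hg => ?_⟩
    obtain ⟨l, hl⟩ := hQ g fun n => by
      have := hg (Nat.le_succ n)
      rw [SModEq.sub_mem, smul_eq_mul, Ideal.mul_top, ← neg_mem_iff, neg_sub] at this
      exact this
    refine ⟨l, fun n => ?_⟩
    rw [SModEq.sub_mem, smul_eq_mul, Ideal.mul_top, ← neg_mem_iff, neg_sub]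
    exact hl n
  have hh : IsHausdorff (J.map f) B := by rw [hI]; exact hB.toIsHausdorff
  refine isNoetherianRing_of_surjective R B f (surjective_of_mk_map_comp_surjective (I := J) f ?_)
  intro y
  obtain ⟨a, rfl⟩ := Ideal.Quotient.mk_surjective y
  obtain ⟨r, hr⟩ := hs a
  refine ⟨r, ?_⟩
  rw [RingHom.comp_apply, eq_comm, Ideal.Quotient.mk_eq_mk_iff_sub_mem, hI]
  exact hr

theorem noeth_completion (A : Type u) [CommRing A] [IsLocalRing A] [IsNoetherianRing A] :
    IsNoetherianRing (AdicCompletion (maximalIdeal A) A) := by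
  classical
  have h0 : HasSrc (AdicCompletion (maximalIdeal A) A) ⊥ := by
    refine ⟨A, inferInstance, ⊥, algebraMap _ _, inferInstance, ?_, Ideal.map_bot, ?_⟩
    · intro f hf
      refine ⟨f 1, fun n => ?_⟩
      cases n with
      | zero => simp
      | succ n =>
        have h : ∀ n, f (n + 1) = f 1 := by
          intro n
          induction n with
          | zero => rfl
          | succ n ih =>
            have := hf (n + 1)
            rw [Ideal.bot_pow (by omega), Ideal.mem_bot, sub_eq_zero] at this
            rw [this, ih]
        rw [h n, sub_self]
        exact Ideal.zero_mem _
    · intro a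
      obtain ⟨y, hy⟩ := (AdicCompletion.residueField_map_bijective (R := A)).2 (residue _ a)
      obtain ⟨r, rfl⟩ := residue_surjective y
      refine ⟨r, ?_⟩
      rw [← residue_eq_zero_iff, map_sub, ← hy, ResidueField.map_residue, sub_self]
  obtain ⟨s, hs⟩ := (maximalIdeal A).fg_of_isNoetherianRing
  have hm : maximalIdeal (AdicCompletion (maximalIdeal A) A) =
      Ideal.span ((s.image (algebraMap A (AdicCompletion (maximalIdeal A) A)) :
        Finset (AdicCompletion (maximalIdeal A) A)) : Set (AdicCompletion (maximalIdeal A) A)) := by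
    rw [AdicCompletion.maximalIdeal_eq_map, Finset.coe_image, ← Ideal.map_span]
    congr 1
    exact hs.symm
  have h1 := h0.list (s.image (algebraMap A (AdicCompletion (maximalIdeal A) A))) (by
    intro x hx
    rw [hm]
    exact Ideal.subset_span hx)
  rw [bot_sup_eq, ← hm] at h1
  exact noeth_of_src h1

theorem izumi_complete {A : Type u} [CommRing A] [IsDomain A] [IsLocalRing A] [IsNoetherianRing A]
    [IsAdicComplete (maximalIdeal A) A] : ∃ C : ℕ, ∀ n (x y : A), x ∉ maximalIdeal A ^ n →
      y ∉ maximalIdeal A ^ n → x * y ∉ maximalIdeal A ^ (C * (n + 1)) := by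
  by_cases hne : maximalIdeal A = ⊥
  · refine ⟨1, fun n x y hx hy => ?_⟩
    have hx0 : x ≠ 0 := by rintro rfl; exact hx (Ideal.zero_mem _)
    have hy0 : y ≠ 0 := by rintro rfl; exact hy (Ideal.zero_mem _)
    rw [hne, Ideal.bot_pow (by omega), Ideal.mem_bot]
    exact mul_ne_zero hx0 hy0
  · rcases cohen (A := A) with ⟨p, h⟩ | ⟨q, hq, hq0, h⟩
    · exact izumi_equal hne h
    · exact izumi_mixed hq hq0 h

theorem mem_pow_iff_completion (A : Type u) [CommRing A] [IsLocalRing A] [IsNoetherianRing A]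
    (n : ℕ) (x : A) : algebraMap A (AdicCompletion (maximalIdeal A) A) x ∈
      maximalIdeal (AdicCompletion (maximalIdeal A) A) ^ n ↔ x ∈ maximalIdeal A ^ n := by
  rw [AdicCompletion.maximalIdeal_eq_map, ← Ideal.map_pow]
  constructor
  · intro h
    have h1 := Ideal.mem_map_of_mem (AdicCompletion.evalₐ (maximalIdeal A) n).toRingHom h
    rw [Ideal.map_map] at h1
    have h2 : (AdicCompletion.evalₐ (maximalIdeal A) n).toRingHom.comp
        (algebraMap A (AdicCompletion (maximalIdeal A) A)) =
        Ideal.Quotient.mk (maximalIdeal A ^ n) := by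
      ext r
      exact (AdicCompletion.evalₐ (maximalIdeal A) n).commutes r
    rw [h2, Ideal.map_quotient_self, Ideal.mem_bot, ← RingHom.comp_apply, h2] at h1
    exact Ideal.Quotient.eq_zero_iff_mem.1 h1
  · exact fun h => Ideal.mem_map_of_mem _ h

theorem izumi_pow (A : Type u) [CommRing A] [IsLocalRing A] [IsNoetherianRing A]
    (hirr : IsDomain (AdicCompletion (maximalIdeal A) A)) :
    ∃ C : ℕ, ∀ n (x y : A), x ∉ maximalIdeal A ^ n →
      y ∉ maximalIdeal A ^ n → x * y ∉ maximalIdeal A ^ (C * (n + 1)) := by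
  have := noeth_completion A
  obtain ⟨C, hC⟩ := izumi_complete (A := AdicCompletion (maximalIdeal A) A)
  refine ⟨C, fun n x y hx hy h => ?_⟩
  rw [← mem_pow_iff_completion] at hx hy h
  rw [map_mul] at h
  exact hC n _ _ hx hy h

theorem bdd_order (A : Type u) [CommRing A] [IsLocalRing A] [IsNoetherianRing A] {x : A}
    (hx : x ≠ 0) : BddAbove {n : ℕ | x ∈ maximalIdeal A ^ n} := by
  by_contra hb
  rw [not_bddAbove_iff] at hb
  apply hx
  have h1 : x ∈ ⨅ n, maximalIdeal A ^ n := by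
    rw [Ideal.mem_iInf]
    intro n
    obtain ⟨m, hm, hn⟩ := hb n
    exact Ideal.pow_le_pow_right hn.le hm
  rwa [Ideal.iInf_pow_eq_bot_of_isLocalRing _ Ideal.IsPrime.ne_top'] at h1

end Izumi


/-- **Izumi's Theorem.**  Let `(A, 𝔪_A)` be a Noetherian local ring which is analytically
irreducible, i.e. whose `𝔪_A`-adic completion is an integral domain.  Then there are
`b ≥ 1` and `d ≥ 0` such that `ord (x * y) ≤ b * (ord x + ord y) + d` for all nonzero
`x, y ∈ A`. -/
theorem izumi {A : Type*} [CommRing A] [IsLocalRing A] [IsNoetherianRing A]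
    (hirr : IsDomain (AdicCompletion (maximalIdeal A) A)) :
    ∃ b d : ℕ, 1 ≤ b ∧ ∀ x y : A, x ≠ 0 → y ≠ 0 →
      mAdicOrder A (x * y) ≤ b * (mAdicOrder A x + mAdicOrder A y) + d := by
  obtain ⟨C, hC⟩ := Izumi.izumi_pow A hirr
  refine ⟨C + 1, 2 * C, by omega, fun x y hx hy => ?_⟩
  have key : ∀ z : A, z ≠ 0 → z ∉ maximalIdeal A ^ (mAdicOrder A z + 1) := by
    intro z hz h
    have := le_csSup (Izumi.bdd_order A hz)
      (show mAdicOrder A z + 1 ∈ {n : ℕ | z ∈ maximalIdeal A ^ n} from h)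
    change mAdicOrder A z + 1 ≤ mAdicOrder A z at this
    omega
  have h1 : x ∉ maximalIdeal A ^ (mAdicOrder A x + mAdicOrder A y + 1) := fun h =>
    key x hx (Ideal.pow_le_pow_right (by omega) h)
  have h2 : y ∉ maximalIdeal A ^ (mAdicOrder A x + mAdicOrder A y + 1) := fun h =>
    key y hy (Ideal.pow_le_pow_right (by omega) h)
  have h3 := hC _ x y h1 h2
  refine csSup_le' fun m hm => ?_
  by_contra hlt
  refine h3 (Ideal.pow_le_pow_right ?_ hm)
  push Not at hlt
  nlinarith
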